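/- arXiv:1810.08325 — 4 statements merged into one kernel-verified Lean document; each statement's English description precedes it below -/
import Mathlib

section
/- For all integers r, s with 2 ≤ r ≤ s, every ordered graph H with fewer than r²s/8 edges admits a red-blue coloring of its edges that contains no red monotone path with r edges and no blue monotone path with s edges. Consequently, the ordered size Ramsey number satisfies r̃(P_r, P_s) ≥ r²s/8. -/
/-- A monotone (increasing) path with `ℓ` edges in an ordered graph `G` on vertex set
`Fin n`: a strictly increasing sequence of `ℓ + 1` vertices with consecutive vertices
adjacent. -/
def IsMonoPath {n ℓ : ℕ} (G : SimpleGraph (Fin n)) (v : Fin (ℓ + 1) → Fin n) : Prop :=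
  StrictMono v ∧ ∀ i : Fin ℓ, G.Adj (v i.castSucc) (v i.succ)

/-- `G` contains a monotone path with `ℓ` edges all of which get the value `b`
under the red-blue edge coloring `col` (queried on ordered pairs `u < v`). -/
def HasPath {n : ℕ} (G : SimpleGraph (Fin n)) (ℓ : ℕ)
    (col : Fin n → Fin n → Bool) (b : Bool) : Prop :=
  ∃ v : Fin (ℓ + 1) → Fin n, IsMonoPath G v ∧
    ∀ i : Fin ℓ, col (v i.castSucc) (v i.succ) = b

/-- The ordered size Ramsey number `r̃(P_r, P_s)`: the minimum number of edges in an
ordered graph such that every red-blue coloring of its edges contains a red monotone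
path with `r` edges or a blue monotone path with `s` edges. -/
noncomputable def orderedSizeRamsey (r s : ℕ) : ℕ :=
  sInf { m | ∃ (n : ℕ) (G : SimpleGraph (Fin n)), G.edgeSet.ncard = m ∧
    ∀ col : Fin n → Fin n → Bool, HasPath G r col true ∨ HasPath G s col false }

open Finset in
/-- A graph spanning fewer than `k (k + 1)` ordered adjacent pairs inside `S` admits a proper
`k`-coloring on `S`. -/
theorem exists_proper_coloring_or_card_le {V : Type*} [Fintype V] [DecidableEq V]
    (G : SimpleGraph V) [DecidableRel G.Adj] {k : ℕ} (hk : 0 < k) (S : Finset V) :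
    (∃ c : V → ℕ, (∀ v, c v < k) ∧ ∀ u ∈ S, ∀ v ∈ S, G.Adj u v → c u ≠ c v) ∨
      k * (k + 1) ≤ #{p ∈ S ×ˢ S | G.Adj p.1 p.2} := by
  induction S using Finset.strongInduction with
  | H S ih =>
    by_cases hdeg : ∃ v ∈ S, #{u ∈ S | G.Adj v u} < k
    · obtain ⟨v, hv, hlt⟩ := hdeg
      rcases ih (S.erase v) (erase_ssubset hv) with ⟨c, hc, hproper⟩ | hcard
      · left
        obtain ⟨x, hxk, hx⟩ : ∃ x ∈ range k, x ∉ image c {u ∈ S | G.Adj v u} :=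
          exists_mem_notMem_of_card_lt_card (by
            rw [card_range]
            exact card_image_le.trans_lt hlt)
        have hne : ∀ u ∈ S, G.Adj v u → c u ≠ x := fun u hu huv h =>
          hx (mem_image.2 ⟨u, mem_filter.2 ⟨hu, huv⟩, h⟩)
        refine ⟨Function.update c v x, fun w => ?_, fun u hu w hw huw => ?_⟩
        · by_cases hwv : w = v
          · subst hwv
            simpa using hxk
          · simpa [hwv] using hc w
        · by_cases huv : u = v
          · subst huv
            have hwu : w ≠ u := huw.ne'
            simpa [hwu] using (hne w hw huw).symm
          · by_cases hwv : w = v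
            · subst hwv
              simpa [huv] using hne u hu huw.symm
            · simpa [huv, hwv] using
                hproper u (mem_erase.2 ⟨huv, hu⟩) w (mem_erase.2 ⟨hwv, hw⟩) huw
      · right
        refine hcard.trans (card_le_card ?_)
        have := erase_subset v S
        gcongr
    · push Not at hdeg
      rcases S.eq_empty_or_nonempty with rfl | ⟨v, hv⟩
      · exact Or.inl ⟨fun _ => 0, fun _ => hk, by simp⟩
      · right
        have hS : k + 1 ≤ #S := by
          refine Nat.succ_le_of_lt ((hdeg v hv).trans_lt (card_lt_card ?_))
          exact filter_ssubset.2 ⟨v, hv, G.loopless.irrefl v⟩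
        have hsum : #{p ∈ S ×ˢ S | G.Adj p.1 p.2} = ∑ v ∈ S, #{u ∈ S | G.Adj v u} := by
          simp only [card_filter, sum_product]
        rw [hsum, mul_comm]
        calc (k + 1) * k ≤ #S * k := by gcongr
          _ ≤ _ := by
            rw [← smul_eq_mul]
            exact card_nsmul_le_sum S _ k hdeg

open Finset in
/-- Greedy interval decomposition: either the vertices from `t` on split into `m` consecutive
intervals, each properly `k`-colored, or they span at least `m k (k + 1)` ordered adjacent
pairs. -/
theorem exists_interval_coloring_or_card_le {n : ℕ} (G : SimpleGraph (Fin n))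
    [DecidableRel G.Adj] {k : ℕ} (hk : 0 < k) (m t : ℕ) :
    (∃ I J : Fin n → ℕ, (∀ v, t ≤ v.1 → I v < m ∧ J v < k) ∧
      ∀ u v : Fin n, t ≤ u.1 → u < v → G.Adj u v → I u < I v ∨ I u = I v ∧ J u ≠ J v) ∨
      m * (k * (k + 1)) ≤ #{p : Fin n × Fin n | t ≤ p.1.1 ∧ t ≤ p.2.1 ∧ G.Adj p.1 p.2} := by
  induction m generalizing t with
  | zero => right; simp
  | succ m ih =>
    let P : ℕ → Prop := fun t' => ∃ c : Fin n → ℕ, (∀ v, c v < k) ∧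
      ∀ u v : Fin n, t ≤ u.1 → t ≤ v.1 → u.1 < t' → v.1 < t' → G.Adj u v → c u ≠ c v
    by_cases hn : P n
    · obtain ⟨c, hc, hproper⟩ := hn
      exact Or.inl ⟨fun _ => 0, c, fun v _ => ⟨m.succ_pos, hc v⟩, fun u v hu huv hadj =>
        Or.inr ⟨rfl, hproper u v hu (hu.trans huv.le) u.2 v.2 hadj⟩⟩
    · have hP0 : P 0 := ⟨fun _ => 0, fun _ => hk, by simp⟩
      obtain ⟨t', ht', hnot⟩ : ∃ t', P t' ∧ ¬ P (t' + 1) := by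
        by_contra! h
        exact hn (Nat.rec hP0 h n)
      obtain ⟨c, hc, hproper⟩ := ht'
      rcases ih t' with ⟨I, J, hIJ, hsep⟩ | hcard
      · left
        refine ⟨fun v => if v.1 < t' then 0 else I v + 1, fun v => if v.1 < t' then c v else J v,
          fun v hv => ?_, fun u v hu huv hadj => ?_⟩
        · by_cases h : v.1 < t'
          · simpa [h] using hc v
          · simpa [h] using hIJ v (not_lt.1 h)
        · have huv' : u.1 < v.1 := huv
          by_cases hv : v.1 < t'
          · have hu' : u.1 < t' := huv'.trans hv
            simpa [hv, hu'] using hproper u v hu (hu.trans huv.le) hu' hv hadj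
          · by_cases hu' : u.1 < t'
            · simp [hv, hu']
            · simpa [hv, hu'] using hsep u v (not_lt.1 hu') huv hadj
      · right
        have hS := exists_proper_coloring_or_card_le G hk
          ({v | t ≤ v.1 ∧ v.1 < t' + 1} : Finset (Fin n))
        have hS := hS.resolve_left (by
          rintro ⟨d, hd, hproper'⟩
          exact hnot ⟨d, hd, fun u v hu hv hu' hv' hadj =>
            hproper' u (by simp; omega) v (by simp; omega) hadj⟩)
        have htt' : t ≤ t' := by
          by_contra! h
          exact hnot ⟨fun _ => 0, fun _ => hk, fun u v hu _ hu' => by omega⟩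
        rw [add_mul, one_mul]
        refine (add_le_add hcard hS).trans ?_
        rw [← card_union_of_disjoint]
        · refine card_le_card fun p => ?_
          simp only [mem_union, mem_filter, mem_univ, true_and, mem_product]
          rintro (⟨h1, h2, h⟩ | ⟨⟨h1, h2⟩, h⟩)
          · exact ⟨htt'.trans h1, htt'.trans h2, h⟩
          · exact ⟨h1.1, h2.1, h⟩
        · rw [disjoint_left]
          intro p
          simp only [mem_filter, mem_univ, true_and, mem_product]
          rintro ⟨h1, h2, h⟩ ⟨⟨h3, h4⟩, -⟩
          exact h.ne (Fin.ext (by omega))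

/-- A color class along which a bounded label strictly increases has no long monotone path. -/
theorem not_hasPath_of_label {n : ℕ} {G : SimpleGraph (Fin n)} {ℓ : ℕ}
    {col : Fin n → Fin n → Bool} {b : Bool} (f : Fin n → ℕ) (hf : ∀ v, f v < ℓ)
    (hlt : ∀ u v, u < v → G.Adj u v → col u v = b → f u < f v) : ¬ HasPath G ℓ col b := by
  rintro ⟨v, ⟨hmono, hadj⟩, hcol⟩
  have hle : ∀ i : Fin (ℓ + 1), (i : ℕ) ≤ f (v i) := by
    intro i
    induction i using Fin.induction with
    | zero => simp
    | succ i ih =>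
      have := hlt _ _ (hmono i.castSucc_lt_succ) (hadj i) (hcol i)
      simp only [Fin.val_castSucc, Fin.val_succ] at ih ⊢
      omega
  have := hle (Fin.last ℓ)
  have := hf (v (Fin.last ℓ))
  simp only [Fin.val_last] at *
  omega

/-- Ordered graphs with fewer than `r² s / 8` edges have a coloring with no red `P_r` and no
blue `P_s`. -/
theorem exists_coloring_of_card_lt {r s : ℕ} (hr : 2 ≤ r) (hrs : r ≤ s) {n : ℕ}
    (H : SimpleGraph (Fin n)) (hH : 8 * H.edgeSet.ncard < r ^ 2 * s) :
    ∃ col : Fin n → Fin n → Bool, ¬ HasPath H r col true ∧ ¬ HasPath H s col false := by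
  classical
  obtain ⟨k, hk1, hk2⟩ : ∃ k, r ≤ 2 * k ∧ 2 * k ≤ r + 1 := ⟨(r + 1) / 2, by omega, by omega⟩
  rcases exists_interval_coloring_or_card_le H (k := k) (by omega) s 0 with
    ⟨I, J, hIJ, hsep⟩ | hcard
  · let x : Fin n → ℕ := fun v => min (I v) (r - k) + J v
    let y : Fin n → ℕ := fun v => (I v - min (I v) (r - k)) + (k - 1 - J v)
    refine ⟨fun u v => decide (x u < x v), not_hasPath_of_label x (fun v => ?_) (by simp),
      not_hasPath_of_label y (fun v => ?_) fun u v huv hadj hcol => ?_⟩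
    · have := hIJ v (Nat.zero_le _)
      simp only [x]
      omega
    · have := hIJ v (Nat.zero_le _)
      simp only [y]
      omega
    · have := hIJ u (Nat.zero_le _)
      have := hIJ v (Nat.zero_le _)
      have := hsep u v (Nat.zero_le _) huv hadj
      simp only [decide_eq_false_iff_not, x, y] at hcol ⊢
      omega
  · exfalso
    have hdarts : Finset.card {p : Fin n × Fin n | 0 ≤ p.1.1 ∧ 0 ≤ p.2.1 ∧ H.Adj p.1 p.2}
        = 2 * H.edgeSet.ncard := by
      rw [← SimpleGraph.coe_edgeFinset, Set.ncard_coe_finset,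
        ← H.sum_degrees_eq_twice_card_edges, Finset.card_filter, Fintype.sum_prod_type]
      refine Finset.sum_congr rfl fun v _ => ?_
      simp [← SimpleGraph.card_neighborFinset_eq_degree, SimpleGraph.neighborFinset_eq_filter]
    rw [hdarts] at hcard
    have h1 : r ^ 2 ≤ (2 * k) ^ 2 := Nat.pow_le_pow_left hk1 2
    have h2 : r ^ 2 * s ≤ (2 * k) ^ 2 * s := Nat.mul_le_mul_right s h1
    nlinarith [Nat.zero_le (s * k)]

/-- `G` has a monotone path of length `ℓ` in color `b` that ends at `w`. -/
def HasPathTo {n : ℕ} (G : SimpleGraph (Fin n)) (ℓ : ℕ)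
    (col : Fin n → Fin n → Bool) (b : Bool) (w : Fin n) : Prop :=
  ∃ v : Fin (ℓ + 1) → Fin n, IsMonoPath G v ∧
    (∀ i : Fin ℓ, col (v i.castSucc) (v i.succ) = b) ∧ v (Fin.last ℓ) = w

theorem HasPathTo.zero {n : ℕ} (G : SimpleGraph (Fin n)) (col : Fin n → Fin n → Bool) (b : Bool)
    (w : Fin n) : HasPathTo G 0 col b w :=
  ⟨fun _ => w, ⟨Subsingleton.strictMono (α := Fin 1) _, fun i => i.elim0⟩, fun i => i.elim0, rfl⟩

theorem HasPathTo.snoc {n : ℕ} {G : SimpleGraph (Fin n)} {ℓ : ℕ} {col : Fin n → Fin n → Bool}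
    {b : Bool} {u w : Fin n} (h : HasPathTo G ℓ col b u) (huw : u < w) (hadj : G.Adj u w)
    (hcol : col u w = b) : HasPathTo G (ℓ + 1) col b w := by
  obtain ⟨v, ⟨hmono, hv⟩, hc, rfl⟩ := h
  have key : ∀ Q : Fin n → Fin n → Prop, (∀ i : Fin ℓ, Q (v i.castSucc) (v i.succ)) →
      Q (v (Fin.last ℓ)) w → ∀ i : Fin (ℓ + 1),
        Q (Fin.snoc (α := fun _ => Fin n) v w i.castSucc)
          (Fin.snoc (α := fun _ => Fin n) v w i.succ) := by
    intro Q h1 h2 i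
    induction i using Fin.lastCases with
    | last => simpa only [Fin.snoc_castSucc, Fin.succ_last, Fin.snoc_last] using h2
    | cast i => simpa only [Fin.snoc_castSucc, Fin.succ_castSucc] using h1 i
  exact ⟨Fin.snoc (α := fun _ => Fin n) v w,
    ⟨Fin.strictMono_iff_lt_succ.2 (key (· < ·) (fun i => hmono i.castSucc_lt_succ) huw),
      key G.Adj hv hadj⟩, key (fun a c => col a c = b) hc hcol, Fin.snoc_last _ _⟩

/-- If there is no path of length `ℓ` in color `b`, the vertices of a complete ordered graph can
be labelled by `0, …, ℓ - 1` so that labels increase along edges of color `b`. -/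
theorem exists_label_of_not_hasPath {n : ℕ} {ℓ : ℕ} {col : Fin n → Fin n → Bool} {b : Bool}
    (h : ¬ HasPath (⊤ : SimpleGraph (Fin n)) ℓ col b) :
    ∃ f : Fin n → Fin ℓ, ∀ u v, u < v → col u v = b → f u < f v := by
  classical
  have hno : ∀ w, ¬ HasPathTo (⊤ : SimpleGraph (Fin n)) ℓ col b w :=
    fun w ⟨v, hv, hc, _⟩ => h ⟨v, hv, hc⟩
  let f : Fin n → ℕ := fun w => Nat.findGreatest (fun m => HasPathTo ⊤ m col b w) ℓ
  have hspec : ∀ w, HasPathTo ⊤ (f w) col b w := fun w =>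
    Nat.findGreatest_spec (P := fun m => HasPathTo ⊤ m col b w) (Nat.zero_le ℓ)
      (HasPathTo.zero ⊤ col b w)
  have hlt : ∀ w, f w < ℓ := fun w =>
    lt_of_le_of_ne (Nat.findGreatest_le ℓ) fun he => hno w (he ▸ hspec w)
  exact ⟨fun w => ⟨f w, hlt w⟩, fun u v huv hc =>
    Nat.le_findGreatest (hlt u) ((hspec u).snoc huv huv.ne hc)⟩

/-- The complete ordered graph on `r s + 1` vertices is Ramsey for `(P_r, P_s)`. -/
theorem hasPath_or_hasPath_top (r s : ℕ) (col : Fin (r * s + 1) → Fin (r * s + 1) → Bool) :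
    HasPath ⊤ r col true ∨ HasPath ⊤ s col false := by
  by_contra! h
  obtain ⟨f, hf⟩ := exists_label_of_not_hasPath h.1
  obtain ⟨g, hg⟩ := exists_label_of_not_hasPath h.2
  obtain ⟨u, v, huv, heq⟩ := Fintype.exists_ne_map_eq_of_card_lt
    (fun w => (f w, g w)) (by simp)
  have hne : ∀ u v, u < v → (f u, g u) ≠ (f v, g v) := by
    intro u v huv heq
    rw [Prod.mk.injEq] at heq
    cases hc : col u v
    · exact (hg u v huv hc).ne heq.2
    · exact (hf u v huv hc).ne heq.1
  rcases huv.lt_or_gt with h | h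
  · exact hne u v h heq
  · exact hne v u h heq.symm

theorem stmt_0 (r s : ℕ) (hr : 2 ≤ r) (hrs : r ≤ s) :
    (∀ (n : ℕ) (H : SimpleGraph (Fin n)),
      (H.edgeSet.ncard : ℝ) < (r : ℝ) ^ 2 * s / 8 →
      ∃ col : Fin n → Fin n → Bool,
        ¬ HasPath H r col true ∧ ¬ HasPath H s col false) ∧
    (r : ℝ) ^ 2 * s / 8 ≤ (orderedSizeRamsey r s : ℝ) := by
  have hcol : ∀ (n : ℕ) (H : SimpleGraph (Fin n)),
      (H.edgeSet.ncard : ℝ) < (r : ℝ) ^ 2 * s / 8 →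
      ∃ col : Fin n → Fin n → Bool,
        ¬ HasPath H r col true ∧ ¬ HasPath H s col false := by
    intro n H hH
    refine exists_coloring_of_card_lt hr hrs H ?_
    rw [lt_div_iff₀ (by norm_num)] at hH
    rw [mul_comm]
    exact_mod_cast hH
  refine ⟨hcol, ?_⟩
  obtain ⟨n, G, hG, hRamsey⟩ := Nat.sInf_mem (s := { m | ∃ (n : ℕ) (G : SimpleGraph (Fin n)),
    G.edgeSet.ncard = m ∧ ∀ col : Fin n → Fin n → Bool,
      HasPath G r col true ∨ HasPath G s col false })
    ⟨_, r * s + 1, ⊤, rfl, hasPath_or_hasPath_top r s⟩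
  rw [orderedSizeRamsey, ← hG]
  by_contra! hlt
  obtain ⟨col, h1, h2⟩ := hcol n G hlt
  exact (hRamsey col).elim h1 h2
end

section
/- Let d, r, s be integers with 0 < d < r ≤ s. Then every ordered graph G with at most d·(r − d)·(s − d) edges admits a red-blue coloring of its edges in which every monotone path whose edges are all red has at most r vertices and every monotone path whose edges are all blue has at most s vertices. In particular, the coloring contains no red monotone path with r edges and no blue monotone path with s edges. -/
/-- The neighbours of `v` that precede it in the vertex order. -/
noncomputable def backNeighbors {n : ℕ} (G : SimpleGraph (Fin n)) (v : Fin n) :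
    Finset (Fin n) :=
  open Classical in {u | u < v ∧ G.Adj u v}

theorem mem_backNeighbors {n : ℕ} {G : SimpleGraph (Fin n)} {u v : Fin n} :
    u ∈ backNeighbors G v ↔ u < v ∧ G.Adj u v := by
  simp [backNeighbors]

theorem sum_card_backNeighbors_le {n : ℕ} (G : SimpleGraph (Fin n)) :
    ∑ v, (backNeighbors G v).card ≤ G.edgeSet.ncard := by
  classical
  rw [← Finset.card_sigma, ← Set.ncard_coe_finset]
  refine Set.ncard_le_ncard_of_injOn (fun p => s(p.2, p.1)) ?_ ?_ (Set.toFinite _)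
  · rintro ⟨v, u⟩ h
    simp only [Finset.mem_coe, Finset.mem_sigma, mem_backNeighbors] at h
    exact h.2.2
  · rintro ⟨v, u⟩ h ⟨v', u'⟩ h' heq
    simp only [Finset.mem_coe, Finset.mem_sigma, mem_backNeighbors] at h h'
    rcases Sym2.eq_iff.1 heq with ⟨rfl, rfl⟩ | ⟨rfl, rfl⟩
    · rfl
    · exact absurd h.2.1 h'.2.1.asymm

/-- Greedy colouring along a well-founded order. -/
theorem exists_greedy_coloring {α : Type*} [LT α] [WellFoundedLT α] (N : α → Finset α)
    (hN : ∀ v, ∀ u ∈ N v, u < v) :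
    ∃ c : α → ℕ, ∀ v, c v ≤ (N v).card ∧ ∀ u ∈ N v, c u ≠ c v := by
  let c : α → ℕ := WellFoundedLT.fix fun v ih =>
    sInf {k | ∀ u (hu : u ∈ N v), ih u (hN v u hu) ≠ k}
  have hc : ∀ v, c v = sInf {k | ∀ u ∈ N v, c u ≠ k} := fun v =>
    WellFoundedLT.fix_eq _ v
  refine ⟨c, fun v => ?_⟩
  obtain ⟨k, hk, hkN⟩ : ∃ k ∈ Finset.range ((N v).card + 1), k ∉ (N v).image c := by
    apply Finset.exists_mem_notMem_of_card_lt_card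
    rw [Finset.card_range]
    exact Nat.lt_succ_of_le Finset.card_image_le
  have hmem : k ∈ {k | ∀ u ∈ N v, c u ≠ k} := fun u hu h =>
    hkN (Finset.mem_image.2 ⟨u, hu, h⟩)
  constructor
  · rw [hc v]
    exact (Nat.sInf_le hmem).trans (Nat.lt_succ_iff.1 (Finset.mem_range.1 hk))
  · have := Nat.sInf_mem ⟨k, hmem⟩
    rwa [← hc v] at this

/-- Vertices can be placed in an `r × s` grid so that every edge increases a coordinate. -/
theorem exists_grid_labeling {d r s n : ℕ} (hd : 0 < d) (hdr : d < r) (hrs : r ≤ s)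
    (G : SimpleGraph (Fin n)) (hsize : G.edgeSet.ncard ≤ d * (r - d) * (s - d)) :
    ∃ x y : Fin n → ℕ, (∀ v, x v < r) ∧ (∀ v, y v < s) ∧
      ∀ u v, u < v → G.Adj u v → x u < x v ∨ y u < y v := by
  classical
  obtain ⟨c, hc⟩ := exists_greedy_coloring (backNeighbors G)
    fun v u hu => (mem_backNeighbors.1 hu).1
  let H : Finset (Fin n) := {v | d ≤ (backNeighbors G v).card}
  have hH : ∀ v, v ∈ H ↔ d ≤ (backNeighbors G v).card := by simp [H]
  have hcardH : H.card ≤ (r - d) * (s - d) := by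
    have h : H.card * d ≤ d * (r - d) * (s - d) :=
      calc H.card * d ≤ ∑ v ∈ H, (backNeighbors G v).card := by
            simpa using Finset.card_nsmul_le_sum H _ d fun v hv => (hH v).1 hv
        _ ≤ ∑ v, (backNeighbors G v).card :=
            Finset.sum_le_sum_of_subset (Finset.subset_univ H)
        _ ≤ _ := (sum_card_backNeighbors_le G).trans hsize
    refine le_of_mul_le_mul_left ?_ hd
    linarith
  let k : Fin n → ℕ := fun v => (H.filter (· < v)).card
  have hk : ∀ v ∈ H, k v < (r - d) * (s - d) := fun v hv =>
    (Finset.card_lt_card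
      (Finset.filter_ssubset (p := (· < v)).2 ⟨v, hv, lt_irrefl v⟩)).trans_le hcardH
  have hkmono : ∀ u v, u ∈ H → u < v → k u < k v := fun u v hu huv => by
    refine Finset.card_lt_card (Finset.ssubset_iff_of_subset ?_ |>.2 ⟨u, ?_, ?_⟩)
    · intro w
      simp only [Finset.mem_filter]
      exact fun h => ⟨h.1, h.2.trans huv⟩
    · simp [hu, huv]
    · simp
  have hsd : 0 < s - d := by omega
  have hdiv : ∀ v ∈ H, k v / (s - d) < r - d := fun v hv =>
    Nat.div_lt_of_lt_mul (by rw [mul_comm]; exact hk v hv)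
  have hcd : ∀ v, v ∉ H → c v < d := fun v hv =>
    (hc v).1.trans_lt (not_le.1 fun h => hv ((hH v).2 h))
  refine ⟨fun v => if v ∈ H then k v / (s - d) else r - d + c v,
    fun v => if v ∈ H then d + k v % (s - d) else d - 1 - c v, fun v => ?_, fun v => ?_,
    fun u v huv hadj => ?_⟩
  · dsimp only
    split_ifs with hv
    · have := hdiv v hv
      omega
    · have := hcd v hv
      omega
  · dsimp only
    have := Nat.mod_lt (k v) hsd
    split_ifs <;> omega
  · dsimp only
    have hne := (hc v).2 u (mem_backNeighbors.2 ⟨huv, hadj⟩)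
    split_ifs with hu hv hv
    · have hlt := hkmono u v hu huv
      rcases (Nat.div_le_div_right (c := s - d) hlt.le).lt_or_eq with h | h
      · exact Or.inl h
      · right
        have h1 := Nat.div_add_mod (k u) (s - d)
        have h2 := Nat.div_add_mod (k v) (s - d)
        rw [h] at h1
        omega
    · have := hdiv u hu
      omega
    · have := hcd u hu
      omega
    · have := hcd u hu
      have := hcd v hv
      omega

theorem StrictMono.card_le_of_forall_lt {ℓ m : ℕ} {f : Fin ℓ → ℕ} (hf : StrictMono f)
    (hlt : ∀ i, f i < m) : ℓ ≤ m := by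
  simpa using Fintype.card_le_of_injective (fun i => (⟨f i, hlt i⟩ : Fin m))
    fun _ _ h => hf.injective (Fin.mk.inj h)

theorem stmt_5 (d r s : ℕ) (hd : 0 < d) (hdr : d < r) (hrs : r ≤ s)
    (n : ℕ) (G : SimpleGraph (Fin n))
    (hsize : G.edgeSet.ncard ≤ d * (r - d) * (s - d)) :
    ∃ col : Fin n → Fin n → Bool,
      -- every all-red monotone path has at most r vertices
      (∀ (ℓ : ℕ) (v : Fin (ℓ + 1) → Fin n), IsMonoPath G v →
        (∀ i : Fin ℓ, col (v i.castSucc) (v i.succ) = true) → ℓ + 1 ≤ r) ∧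
      -- every all-blue monotone path has at most s vertices
      (∀ (ℓ : ℕ) (v : Fin (ℓ + 1) → Fin n), IsMonoPath G v →
        (∀ i : Fin ℓ, col (v i.castSucc) (v i.succ) = false) → ℓ + 1 ≤ s) ∧
      -- in particular, no red monotone path with r edges and no blue one with s edges
      (¬ ∃ v : Fin (r + 1) → Fin n, IsMonoPath G v ∧
        ∀ i : Fin r, col (v i.castSucc) (v i.succ) = true) ∧
      (¬ ∃ v : Fin (s + 1) → Fin n, IsMonoPath G v ∧
        ∀ i : Fin s, col (v i.castSucc) (v i.succ) = false) := by
  obtain ⟨x, y, hx, hy, hxy⟩ := exists_grid_labeling hd hdr hrs G hsize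
  have hred : ∀ (ℓ : ℕ) (v : Fin (ℓ + 1) → Fin n), IsMonoPath G v →
      (∀ i : Fin ℓ, decide (x (v i.castSucc) < x (v i.succ)) = true) → ℓ + 1 ≤ r :=
    fun ℓ v _ hcol => (Fin.strictMono_iff_lt_succ (f := x ∘ v).2
      fun i => of_decide_eq_true (hcol i)).card_le_of_forall_lt fun i => hx (v i)
  have hblue : ∀ (ℓ : ℕ) (v : Fin (ℓ + 1) → Fin n), IsMonoPath G v →
      (∀ i : Fin ℓ, decide (x (v i.castSucc) < x (v i.succ)) = false) → ℓ + 1 ≤ s :=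
    fun ℓ v hv hcol => (Fin.strictMono_iff_lt_succ (f := y ∘ v).2
      fun i => (hxy _ _ (hv.1 i.castSucc_lt_succ) (hv.2 i)).resolve_left
        (of_decide_eq_false (hcol i))).card_le_of_forall_lt fun i => hy (v i)
  refine ⟨fun u v => decide (x u < x v), hred, hblue, ?_, ?_⟩
  · rintro ⟨v, hv, hcol⟩
    exact absurd (hred r v hv hcol) (by omega)
  · rintro ⟨v, hv, hcol⟩
    exact absurd (hblue s v hv hcol) (by omega)
end

section
/- There exists a constant C > 0 such that for all integers r, s with 2 ≤ r ≤ s, there exists an ordered graph G with at most s·exp(C·(log r)·√(log s)) edges such that every red-blue coloring of the edges of G contains a red monotone path with r edges or a blue monotone path with s edges. Consequently, r̃(P_r, P_s) ≤ s·exp(C·(log r)·√(log s)). -/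
/-- `p 0, …, p L` is a path in the edge set `E` all of whose vertices lie in `S`. -/
def IsPathIn (E : Finset (ℕ × ℕ)) (S : Set ℕ) (L : ℕ) (p : ℕ → ℕ) : Prop :=
  (∀ i ≤ L, p i ∈ S) ∧ ∀ i < L, (p i, p (i + 1)) ∈ E

lemma IsPathIn.append {E : Finset (ℕ × ℕ)} {S : Set ℕ} {n m : ℕ} {p q : ℕ → ℕ}
    (hp : IsPathIn E S n p) (hq : IsPathIn E S m q) (h : p n = q 0) :
    ∃ t, IsPathIn E S (n + m) t ∧ t (n + m) = q m := by
  refine ⟨fun i => if i < n then p i else q (i - n), ⟨fun i hi => ?_, fun i hi => ?_⟩, ?_⟩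
  · dsimp only
    split_ifs with h1
    · exact hp.1 i h1.le
    · exact hq.1 _ (by omega)
  · dsimp only
    rcases lt_trichotomy (i + 1) n with h1 | h1 | h1
    · rw [if_pos (by omega), if_pos h1]
      exact hp.2 i (by omega)
    · rw [if_pos (by omega), if_neg (by omega), h1, Nat.sub_self, ← h, ← h1]
      exact hp.2 i (by omega)
    · rw [if_neg (by omega), if_neg (by omega), Nat.sub_add_comm (by omega)]
      exact hq.2 _ (by omega)
  · simp

lemma IsPathIn.snoc {E : Finset (ℕ × ℕ)} {S : Set ℕ} {n v : ℕ} {p : ℕ → ℕ}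
    (hp : IsPathIn E S n p) (hv : v ∈ S) (h : (p n, v) ∈ E) :
    ∃ t, IsPathIn E S (n + 1) t ∧ t (n + 1) = v := by
  have hq : IsPathIn E S 1 (fun i => if i = 0 then p n else v) := by
    refine ⟨fun i hi => ?_, fun i hi => ?_⟩
    · dsimp only
      split_ifs
      · exact hp.1 n le_rfl
      · exact hv
    · obtain rfl : i = 0 := by omega
      simpa using h
  simpa using hp.append hq (by simp)

/-- `E` is an ordered graph on `{0, …, N - 1}` in which every `r`-colouring of the vertices has a
monochromatic monotone path with `L` edges. -/
def VertexArrows (E : Finset (ℕ × ℕ)) (N r L : ℕ) : Prop :=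
  (∀ e ∈ E, e.1 < e.2 ∧ e.2 < N) ∧
    ∀ c : ℕ → Fin r, ∃ a p, IsPathIn E {v | v < N ∧ c v = a} L p

/-- A sparse bipartite graph in which any two sets of at least `a` vertices are joined. -/
lemma exists_sparse_joined (N a d : ℕ) (hN : 0 < N) (had : 2 * N ^ 2 ≤ d * a ^ 2) :
    ∃ D : Finset (ℕ × ℕ), D.card ≤ N * d ∧ (∀ e ∈ D, e.1 < N ∧ e.2 < N) ∧
      ∀ A B : Finset ℕ, A ⊆ Finset.range N → B ⊆ Finset.range N → a ≤ A.card → a ≤ B.card →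
        ∃ x ∈ A, ∃ y ∈ B, (x, y) ∈ D := by
  classical
  have key : ∃ φ : Fin N × Fin d → Fin N, ∀ A B : Finset (Fin N), a ≤ A.card → a ≤ B.card →
      ∃ x ∈ A, ∃ j, φ (x, j) ∈ B := by
    by_contra! hcon
    let bad : Finset (Fin N) × Finset (Fin N) → Finset (Fin N × Fin d → Fin N) := fun P =>
      Fintype.piFinset fun z => if z.1 ∈ P.1 then P.2ᶜ else Finset.univ
    let I : Finset (Finset (Fin N) × Finset (Fin N)) :=
      Finset.univ.filter fun P => a ≤ P.1.card ∧ a ≤ P.2.card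
    have hcover : (Finset.univ : Finset (Fin N × Fin d → Fin N)) ⊆ I.biUnion bad := by
      intro φ _
      obtain ⟨A, B, hA, hB, h⟩ := hcon φ
      simp only [Finset.mem_biUnion]
      refine ⟨(A, B), by simp [I, hA, hB], ?_⟩
      simp only [bad, Fintype.mem_piFinset]
      rintro ⟨x, j⟩
      by_cases hx : x ∈ A
      · simpa [hx] using h x hx j
      · simp [hx]
    have hbad : ∀ P ∈ I, ((bad P).card : ℝ) ≤ (N : ℝ) ^ (N * d) * Real.exp (-(2 * N)) := by
      rintro ⟨A, B⟩ hP
      simp only [I, Finset.mem_filter, Finset.mem_univ, true_and] at hP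
      have hNR : (0 : ℝ) < N := by exact_mod_cast hN
      have hBN : B.card ≤ N := by simpa using Finset.card_le_univ B
      have h1 : ((bad (A, B)).card : ℝ) = ∏ z : Fin N × Fin d,
          ((N : ℝ) * if z.1 ∈ A then (1 - (B.card : ℝ) / N) else 1) := by
        simp only [bad, Fintype.card_piFinset]
        push_cast
        refine Finset.prod_congr rfl fun z _ => ?_
        split_ifs
        · rw [Finset.card_compl, Fintype.card_fin, Nat.cast_sub hBN]
          field_simp
        · simp
      rw [h1, Finset.prod_mul_distrib]
      simp only [Finset.prod_const, Finset.card_univ, Fintype.card_prod, Fintype.card_fin]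
      gcongr
      have h2 : ∀ z : Fin N × Fin d, (if z.1 ∈ A then (1 - (B.card : ℝ) / N) else 1) ≤
          Real.exp (if z.1 ∈ A then -((B.card : ℝ) / N) else 0) := by
        intro z
        split_ifs
        · linarith [Real.add_one_le_exp (-((B.card : ℝ) / N))]
        · simp
      have h3 : (B.card : ℝ) / N ≤ 1 := by
        rw [div_le_one hNR]
        exact_mod_cast hBN
      refine (Finset.prod_le_prod (fun z _ => ?_) fun z _ => h2 z).trans ?_
      · split_ifs
        · linarith
        · simp
      rw [← Real.exp_sum, Real.exp_le_exp, Fintype.sum_prod_type]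
      change (∑ x : Fin N, ∑ _j : Fin d, if x ∈ A then -((B.card : ℝ) / N) else 0) ≤ _
      simp only [Finset.sum_const, Finset.card_univ, Fintype.card_fin, nsmul_eq_mul, mul_ite,
        mul_zero, Finset.sum_ite_mem, Finset.univ_inter]
      have h4 : (2 : ℝ) * N ^ 2 ≤ A.card * (d * B.card) := by
        have : 2 * N ^ 2 ≤ A.card * (d * B.card) := by
          calc 2 * N ^ 2 ≤ d * a ^ 2 := had
            _ = a * (d * a) := by ring
            _ ≤ _ := by gcongr <;> tauto
        exact_mod_cast this
      have h5 : (A.card : ℝ) * (d * -((B.card : ℝ) / N)) = -((A.card * (d * B.card)) / N) := by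
        ring
      rw [h5, neg_le_neg_iff, le_div_iff₀ hNR]
      nlinarith
    have hcard : ((N : ℝ) ^ (N * d)) ≤
        (4 : ℝ) ^ N * ((N : ℝ) ^ (N * d) * Real.exp (-(2 * N))) := by
      have h1 := (Finset.card_le_card hcover).trans Finset.card_biUnion_le
      have h2 : (Finset.univ : Finset (Fin N × Fin d → Fin N)).card = N ^ (N * d) := by simp
      rw [h2] at h1
      have h3 : I.card ≤ 4 ^ N := by
        refine (Finset.card_le_univ I).trans ?_
        simp [← mul_pow]
      calc ((N : ℝ) ^ (N * d)) ≤ ∑ P ∈ I, ((bad P).card : ℝ) := by exact_mod_cast h1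
        _ ≤ ∑ P ∈ I, (N : ℝ) ^ (N * d) * Real.exp (-(2 * N)) := Finset.sum_le_sum hbad
        _ = I.card * ((N : ℝ) ^ (N * d) * Real.exp (-(2 * N))) := by simp
        _ ≤ _ := by
          gcongr
          exact_mod_cast h3
    have hpos : (0 : ℝ) < (N : ℝ) ^ (N * d) := by positivity
    have h4 : (4 : ℝ) ^ N * Real.exp (-(2 * N)) < 1 := by
      have h5 : Real.exp (-(2 * N)) = Real.exp (-2) ^ N := by
        rw [← Real.exp_nat_mul]
        ring_nf
      rw [h5, ← mul_pow]
      refine pow_lt_one₀ (by positivity) ?_ hN.ne'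
      rw [Real.exp_neg, ← div_eq_mul_inv, div_lt_one (Real.exp_pos _)]
      have h6 : Real.exp 2 = Real.exp 1 ^ 2 := by rw [← Real.exp_nat_mul]; norm_num
      rw [h6]
      nlinarith [Real.exp_one_gt_d9]
    nlinarith
  obtain ⟨φ, hφ⟩ := key
  refine ⟨Finset.univ.image fun z : Fin N × Fin d => ((z.1 : ℕ), (φ z : ℕ)), ?_, ?_, ?_⟩
  · exact Finset.card_image_le.trans (by simp)
  · simp only [Finset.mem_image]
    rintro _ ⟨z, -, rfl⟩
    exact ⟨z.1.2, (φ z).2⟩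
  · intro A B hA hB hAa hBa
    obtain ⟨x, hx, j, hj⟩ := hφ
      (A.attachFin fun n hn => Finset.mem_range.1 (hA hn))
      (B.attachFin fun n hn => Finset.mem_range.1 (hB hn)) (by simpa) (by simpa)
    rw [Finset.mem_attachFin] at hx hj
    exact ⟨x, hx, _, hj, Finset.mem_image.2 ⟨(x, j), Finset.mem_univ _, rfl⟩⟩

lemma IsPathIn.strictMonoOn {E : Finset (ℕ × ℕ)} {S : Set ℕ} {L : ℕ} {p : ℕ → ℕ}
    (hp : IsPathIn E S L p) (hE : ∀ e ∈ E, e.1 < e.2) : StrictMonoOn p (Set.Iic L) := by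
  have key : ∀ j ≤ L, ∀ i < j, p i < p j := by
    intro j
    induction j with
    | zero => intro _ i hi; omega
    | succ j ih =>
      intro hj i hi
      have h1 : p j < p (j + 1) := hE _ (hp.2 j hj)
      rcases Nat.lt_succ_iff_lt_or_eq.1 hi with h | rfl
      · exact (ih (by omega) i h).trans h1
      · exact h1
  exact fun i _ j hj hij => key j hj i hij

lemma VertexArrows.blowup {E : Finset (ℕ × ℕ)} {N r L : ℕ} (h : VertexArrows E N r L)
    (hN : 0 < N) (m d : ℕ) (hd : 2 * N ^ 2 ≤ d * (L / 3 + 1) ^ 2) :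
    ∃ E', VertexArrows E' ((3 * m * r + 1) * N) r (m * (L + 3)) ∧
      E'.card ≤ (3 * m * r + 1) * E.card + (3 * m * r + 1) ^ 2 * (N * d) := by
  classical
  obtain ⟨D, hDcard, hDlt, hD⟩ := exists_sparse_joined N (L / 3 + 1) d hN hd
  set M := 3 * m * r + 1 with hM
  let inner : Finset (ℕ × ℕ) :=
    (Finset.range M ×ˢ E).image fun z => (z.1 * N + z.2.1, z.1 * N + z.2.2)
  let outer : Finset (ℕ × ℕ) :=
    (((Finset.range M ×ˢ Finset.range M).filter fun z => z.1 < z.2) ×ˢ D).image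
      fun z => (z.1.1 * N + z.2.1, z.1.2 * N + z.2.2)
  have hblock : ∀ b < M, ∀ x < N, b * N + x < M * N := by
    intro b hb x hx
    calc b * N + x < (b + 1) * N := by rw [add_mul]; omega
      _ ≤ M * N := Nat.mul_le_mul_right _ hb
  refine ⟨inner ∪ outer, ⟨?_, ?_⟩, ?_⟩
  · intro e he
    rcases Finset.mem_union.1 he with he | he
    · obtain ⟨⟨b, x, y⟩, hz, rfl⟩ := Finset.mem_image.1 he
      simp only [Finset.mem_product, Finset.mem_range] at hz
      have := h.1 _ hz.2
      exact ⟨by simpa using this.1, hblock _ hz.1 _ this.2⟩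
    · obtain ⟨⟨⟨b, b'⟩, x, y⟩, hz, rfl⟩ := Finset.mem_image.1 he
      simp only [Finset.mem_product, Finset.mem_filter, Finset.mem_range] at hz
      obtain ⟨⟨⟨hb, hb'⟩, hlt⟩, hxy⟩ := hz
      have := hDlt _ hxy
      refine ⟨?_, hblock _ hb' _ this.2⟩
      calc b * N + x < (b + 1) * N := by rw [add_mul]; omega
        _ ≤ b' * N := Nat.mul_le_mul_right _ hlt
        _ ≤ b' * N + y := Nat.le_add_right _ _
  · intro c
    choose a p hp using fun b : ℕ => h.2 fun v => c (b * N + v)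
    obtain ⟨y, -, hy⟩ := Finset.exists_lt_card_fiber_of_mul_lt_card_of_maps_to
      (s := Finset.range M) (t := (Finset.univ : Finset (Fin r))) (f := a) (n := 3 * m)
      (fun _ _ => Finset.mem_univ _) (by simp [hM, mul_comm])
    set T := (Finset.range M).filter fun b => a b = y
    obtain ⟨g, hgT, hg⟩ : ∃ g : ℕ → ℕ, (∀ j ≤ 3 * m, g j ∈ T) ∧ ∀ j < 3 * m, g j < g (j + 1) := by
      refine ⟨fun j => if hj : j < T.card then T.orderEmbOfFin rfl ⟨j, hj⟩ else 0, ?_, ?_⟩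
      · intro j hj
        dsimp only
        rw [dif_pos (by omega)]
        exact Finset.orderEmbOfFin_mem _ _ _
      · intro j hj
        dsimp only
        rw [dif_pos (by omega), dif_pos (by omega)]
        simp
    have hmono : ∀ b, StrictMonoOn (p b) (Set.Iic L) := fun b =>
      (hp b).strictMonoOn fun e he => (h.1 e he).1
    have hcard : ∀ b l, (∀ i ∈ Finset.Icc l (l + L / 3), i ≤ L) →
        L / 3 + 1 ≤ ((Finset.Icc l (l + L / 3)).image (p b)).card := by
      intro b l hl
      rw [Finset.card_image_of_injOn]
      · simp; omega
      · exact (hmono b).injOn.mono fun i hi => hl i (by simpa using hi)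
    have hsub : ∀ b l, (∀ i ∈ Finset.Icc l (l + L / 3), i ≤ L) →
        (Finset.Icc l (l + L / 3)).image (p b) ⊆ Finset.range N := by
      intro b l hl v hv
      obtain ⟨i, hi, rfl⟩ := Finset.mem_image.1 hv
      exact Finset.mem_range.2 ((hp b).1 i (hl i hi)).1
    have hhead : ∀ i ∈ Finset.Icc 0 (0 + L / 3), i ≤ L := by
      intro i hi
      rw [Finset.mem_Icc] at hi
      omega
    have htail : ∀ i ∈ Finset.Icc (L - L / 3) (L - L / 3 + L / 3), i ≤ L := by
      intro i hi
      rw [Finset.mem_Icc] at hi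
      omega
    have hS : ∀ b ∈ T, ∀ i ≤ L, b * N + p b i ∈ {v | v < M * N ∧ c v = y} := by
      intro b hb i hi
      have hb' := Finset.mem_filter.1 hb
      have := (hp b).1 i hi
      exact ⟨hblock b (Finset.mem_range.1 hb'.1) _ this.1, this.2.trans hb'.2⟩
    have claim : ∀ j ≤ 3 * m, ∃ n q x, j * (L + 3) ≤ 3 * n ∧ x ≤ L / 3 ∧
        IsPathIn (inner ∪ outer) {v | v < M * N ∧ c v = y} n q ∧
        q n = g j * N + p (g j) x := by
      intro j
      induction j with
      | zero =>
        intro _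
        refine ⟨0, fun _ => g 0 * N + p (g 0) 0, 0, by simp, by simp, ⟨?_, by simp⟩, rfl⟩
        intro _ _
        exact hS _ (hgT 0 (by omega)) 0 (by omega)
      | succ j ih =>
        intro hj
        obtain ⟨n, q, x, hn, hx, hq, hqn⟩ := ih (by omega)
        have hgj := hgT j (by omega)
        have hgj' := hgT (j + 1) hj
        have hgM := (Finset.mem_filter.1 hgj).1
        have hgM' := (Finset.mem_filter.1 hgj').1
        obtain ⟨u, hu, v, hv, huv⟩ := hD _ _ (hsub (g j) _ htail) (hsub (g (j + 1)) _ hhead)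
          (hcard (g j) _ htail) (hcard (g (j + 1)) _ hhead)
        obtain ⟨t, ht, rfl⟩ := Finset.mem_image.1 hu
        obtain ⟨x', hx', rfl⟩ := Finset.mem_image.1 hv
        rw [Finset.mem_Icc] at ht hx'
        have hseg : IsPathIn (inner ∪ outer) {v | v < M * N ∧ c v = y} (t - x)
            fun i => g j * N + p (g j) (x + i) := by
          refine ⟨fun i hi => hS _ hgj _ (by omega), fun i hi => ?_⟩
          refine Finset.mem_union_left _ (Finset.mem_image.2
            ⟨(g j, p (g j) (x + i), p (g j) (x + i + 1)), ?_, rfl⟩)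
          exact Finset.mem_product.2 ⟨hgM, (hp (g j)).2 _ (by omega)⟩
        obtain ⟨q', hq', hqe⟩ := hq.append hseg (by simpa using hqn)
        rw [Nat.add_sub_cancel' (by omega)] at hqe
        obtain ⟨q'', hq'', hqe'⟩ := hq'.snoc (hS _ hgj' x' (by omega)) (by
          rw [hqe]
          refine Finset.mem_union_right _ (Finset.mem_image.2
            ⟨((g j, g (j + 1)), p (g j) t, p (g (j + 1)) x'), ?_, rfl⟩)
          exact Finset.mem_product.2 ⟨Finset.mem_filter.2
            ⟨Finset.mem_product.2 ⟨hgM, hgM'⟩, hg j (by omega)⟩, huv⟩)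
        refine ⟨_, q'', x', ?_, by omega, hq'', hqe'⟩
        rw [add_mul]
        omega
    obtain ⟨n, q, -, hn, -, hq, -⟩ := claim (3 * m) le_rfl
    have hmn : m * (L + 3) ≤ n := by
      rw [mul_assoc] at hn
      omega
    exact ⟨y, q, fun i hi => hq.1 i (hi.trans hmn), fun i hi => hq.2 i (hi.trans_le hmn)⟩
  · refine (Finset.card_union_le _ _).trans (add_le_add ?_ ?_)
    · exact Finset.card_image_le.trans (by simp)
    · refine Finset.card_image_le.trans ?_
      rw [Finset.card_product]
      refine Nat.mul_le_mul ((Finset.card_filter_le _ _).trans ?_) hDcard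
      simp [sq]

lemma exists_vertexArrows (r m : ℕ) (hr : 0 < r) (hm : 0 < m) (k : ℕ) :
    ∃ E L, VertexArrows E ((3 * m * r + 1) ^ k) r L ∧ m ^ k ≤ L + 1 ∧
      E.card ≤ 18 * k * (3 * m * r + 1) ^ (k + 1) * (16 * r ^ 2) ^ k := by
  induction k with
  | zero =>
    refine ⟨∅, 0, ⟨by simp, fun c => ⟨c 0, fun _ => 0, ?_, by simp⟩⟩, by simp, by simp⟩
    simp
  | succ k ih =>
    obtain ⟨E, L, hE, hL, hcard⟩ := ih
    have hmr : 3 * m * r + 1 ≤ 4 * m * r := by nlinarith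
    obtain ⟨E', hE', hcard'⟩ := hE.blowup (by positivity) m (18 * (16 * r ^ 2) ^ k) (by
      calc 2 * ((3 * m * r + 1) ^ k) ^ 2 ≤ 2 * ((4 * m * r) ^ k) ^ 2 := by gcongr
        _ = 2 * (16 * r ^ 2) ^ k * (m ^ k) ^ 2 := by
          simp only [← pow_mul, mul_comm k 2]
          simp only [pow_mul, mul_assoc, ← mul_pow]
          ring
        _ ≤ 2 * (16 * r ^ 2) ^ k * (3 * (L / 3 + 1)) ^ 2 := by
          gcongr
          omega
        _ = _ := by ring)
    refine ⟨E', m * (L + 3), by rwa [pow_succ'], ?_, hcard'.trans ?_⟩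
    · rw [pow_succ']
      nlinarith
    · set M := 3 * m * r + 1
      calc M * E.card + M ^ 2 * (M ^ k * (18 * (16 * r ^ 2) ^ k))
          ≤ M * (18 * k * M ^ (k + 1) * (16 * r ^ 2) ^ k)
            + M ^ 2 * (M ^ k * (18 * (16 * r ^ 2) ^ k)) := by gcongr
        _ = 18 * (k + 1) * M ^ (k + 1 + 1) * (16 * r ^ 2) ^ k := by ring
        _ ≤ 18 * (k + 1) * M ^ (k + 1 + 1) * (16 * r ^ 2) ^ (k + 1) := by
          gcongr
          · nlinarith
          · omega

/-- Colour each vertex by the length of the longest red path ending there: the edges inside a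
colour class are blue. -/
lemma VertexArrows.edge_arrows {E : Finset (ℕ × ℕ)} {N r L : ℕ} (h : VertexArrows E N r L)
    (hr : 0 < r) (R : Finset (ℕ × ℕ)) :
    (∃ p, IsPathIn (E ∩ R) (Set.Iio N) r p) ∨ ∃ p, IsPathIn (E \ R) (Set.Iio N) L p := by
  classical
  by_cases hred : ∃ p, IsPathIn (E ∩ R) (Set.Iio N) r p
  · exact Or.inl hred
  right
  let Q : ℕ → ℕ → Prop := fun v l => ∃ p, IsPathIn (E ∩ R) (Set.Iio N) l p ∧ p l = v
  let lev : ℕ → ℕ := fun v => Nat.findGreatest (Q v) (r - 1)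
  have hlev : ∀ v, lev v < r := fun v => by
    have : lev v ≤ r - 1 := Nat.findGreatest_le _
    omega
  have hQ0 : ∀ v < N, Q v 0 := fun v hv => ⟨fun _ => v, ⟨fun _ _ => hv, by simp⟩, rfl⟩
  have hstep : ∀ e ∈ E ∩ R, lev e.1 < lev e.2 := by
    rintro ⟨u, v⟩ he
    have hE := h.1 _ (Finset.mem_inter.1 he).1
    obtain ⟨p, hp, hpu⟩ : Q u (lev u) :=
      Nat.findGreatest_spec (Nat.zero_le _) (hQ0 u (hE.1.trans hE.2))
    obtain ⟨t, ht, htv⟩ := hp.snoc (v := v) hE.2 (by rwa [hpu])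
    have hne : lev u + 1 ≠ r := fun heq => hred ⟨t, heq ▸ ht⟩
    have := hlev u
    change lev u < lev v
    exact Nat.le_findGreatest (by omega) ⟨t, ht, htv⟩
  obtain ⟨a, p, hp⟩ := h.2 fun v => ⟨lev v, hlev v⟩
  refine ⟨p, fun i hi => (hp.1 i hi).1, fun i hi => Finset.mem_sdiff.2 ⟨hp.2 i hi, fun hR => ?_⟩⟩
  have h1 := hstep _ (Finset.mem_inter.2 ⟨hp.2 i hi, hR⟩)
  have h2 := (hp.1 i hi.le).2.trans (hp.1 (i + 1) hi).2.symm
  rw [Fin.mk.injEq] at h2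
  exact h1.ne h2

/-- The ordered graph on `Fin N` with edge set `E`. -/
def orderedGraph (E : Finset (ℕ × ℕ)) (N : ℕ) : SimpleGraph (Fin N) :=
  SimpleGraph.fromRel fun u v => ((u : ℕ), (v : ℕ)) ∈ E

lemma ncard_edgeSet_orderedGraph_le (E : Finset (ℕ × ℕ)) (N : ℕ) [NeZero N] :
    (orderedGraph E N).edgeSet.ncard ≤ E.card := by
  classical
  have hsub : (orderedGraph E N).edgeSet ⊆
      ↑(E.image fun e => s(Fin.ofNat N e.1, Fin.ofNat N e.2)) := by
    intro e
    induction e with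
    | _ u v =>
      simp only [SimpleGraph.mem_edgeSet, orderedGraph, SimpleGraph.fromRel_adj, Finset.coe_image,
        Set.mem_image]
      rintro ⟨-, h | h⟩
      · exact ⟨_, h, by simp⟩
      · exact ⟨_, h, by simp [Sym2.eq_swap]⟩
  refine (Set.ncard_le_ncard hsub (Finset.finite_toSet _)).trans ?_
  rw [Set.ncard_coe_finset]
  exact Finset.card_image_le

lemma IsPathIn.hasPath {E F : Finset (ℕ × ℕ)} {N l l' : ℕ} [NeZero N] {p : ℕ → ℕ}
    (hp : IsPathIn F (Set.Iio N) l p) (hl : l' ≤ l) (hE : ∀ e ∈ E, e.1 < e.2) (hF : F ⊆ E)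
    {col : Fin N → Fin N → Bool} {b : Bool}
    (hcol : ∀ e ∈ F, col (Fin.ofNat N e.1) (Fin.ofNat N e.2) = b) :
    HasPath (orderedGraph E N) l' col b := by
  have hval : ∀ i ≤ l, (Fin.ofNat N (p i) : ℕ) = p i := fun i hi =>
    Nat.mod_eq_of_lt (hp.1 i hi)
  refine ⟨fun i => Fin.ofNat N (p i), ⟨?_, ?_⟩, fun i => ?_⟩
  · intro i j hij
    rw [Fin.lt_def, hval _ (by omega), hval _ (by omega)]
    exact hp.strictMonoOn (fun e he => hE e (hF he)) (Set.mem_Iic.2 (by omega))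
      (Set.mem_Iic.2 (by omega)) hij
  · intro i
    have he := hF (hp.2 i (by omega))
    have h1 := hval i (by omega)
    have h2 := hval (i + 1) (by omega)
    refine SimpleGraph.fromRel_adj _ _ _ |>.2 ⟨fun heq => ?_, Or.inl ?_⟩
    · have h3 : p i = p (i + 1) := by
        rw [← h1, ← h2]
        exact congrArg Fin.val heq
      exact (hE _ he).ne h3
    · simpa only [Fin.val_castSucc, Fin.val_succ, h1, h2] using he
  · exact hcol _ (hp.2 i (by omega))

lemma exists_orderedGraph_arrows (r s m k : ℕ) (hr : 0 < r) (hm : 0 < m) (hs : s < m ^ k) :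
    ∃ (n : ℕ) (G : SimpleGraph (Fin n)),
      G.edgeSet.ncard ≤ 18 * k * (3 * m * r + 1) ^ (k + 1) * (16 * r ^ 2) ^ k ∧
      ∀ col : Fin n → Fin n → Bool, HasPath G r col true ∨ HasPath G s col false := by
  classical
  obtain ⟨E, L, hE, hL, hcard⟩ := exists_vertexArrows r m hr hm k
  have hlt : ∀ e ∈ E, e.1 < e.2 := fun e he => (hE.1 e he).1
  set N := (3 * m * r + 1) ^ k
  have : NeZero N := ⟨by positivity⟩
  refine ⟨N, orderedGraph E N, (ncard_edgeSet_orderedGraph_le E N).trans hcard, fun col => ?_⟩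
  rcases hE.edge_arrows hr
    (E.filter fun e => col (Fin.ofNat N e.1) (Fin.ofNat N e.2) = true) with ⟨p, hp⟩ | ⟨p, hp⟩
  · refine Or.inl (hp.hasPath le_rfl hlt Finset.inter_subset_left fun e he => ?_)
    exact (Finset.mem_filter.1 (Finset.mem_inter.1 he).2).2
  · refine Or.inr (hp.hasPath (by omega) hlt Finset.sdiff_subset fun e he => ?_)
    have h1 := Finset.mem_sdiff.1 he
    simpa [h1.1] using h1.2

lemma edge_bound {r s : ℕ} (hr : 2 ≤ r) (hs : 2 ≤ s) :
    ∃ m k : ℕ, 0 < m ∧ s < m ^ k ∧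
      ((18 * k * (3 * m * r + 1) ^ (k + 1) * (16 * r ^ 2) ^ k : ℕ) : ℝ) ≤
        s * Real.exp (100 * Real.log r * Real.sqrt (Real.log s)) := by
  have hsR : (2 : ℝ) ≤ s := by exact_mod_cast hs
  have hrR : (2 : ℝ) ≤ r := by exact_mod_cast hr
  have hl2 := Real.log_two_gt_d9
  have hls : Real.log 2 ≤ Real.log s := Real.log_le_log (by norm_num) hsR
  have hlr : Real.log 2 ≤ Real.log r := Real.log_le_log (by norm_num) hrR
  set t := Real.sqrt (Real.log s) with ht
  have ht2 : t * t = Real.log s := Real.mul_self_sqrt (by linarith)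
  have ht0 : 0.8 ≤ t := by
    rw [ht]
    exact Real.le_sqrt_of_sq_le (by linarith)
  set k := ⌈t⌉₊ with hk
  have hk1 : t ≤ k := Nat.le_ceil t
  have hk2 : (k : ℝ) < t + 1 := Nat.ceil_lt_add_one (by linarith)
  have hkpos : 0 < k := Nat.ceil_pos.2 (by linarith)
  set w := Real.exp (Real.log s / k) with hw
  have hkR : (0 : ℝ) < k := by exact_mod_cast hkpos
  have hw1 : 1 ≤ w := Real.one_le_exp (by positivity)
  have hwk : w ^ k = s := by
    rw [hw, ← Real.exp_nat_mul, mul_div_cancel₀ _ hkR.ne', Real.exp_log (by linarith)]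
  have hwt : w ≤ Real.exp t := by
    rw [hw, Real.exp_le_exp, div_le_iff₀ hkR]
    nlinarith
  set m := ⌊w⌋₊ + 1 with hm
  have hm1 : w < m := by exact_mod_cast Nat.lt_floor_add_one w
  have hm2 : (m : ℝ) ≤ 2 * w := by
    have := Nat.floor_le (by linarith : 0 ≤ w)
    push_cast [hm]
    linarith
  refine ⟨m, k, by omega, ?_, ?_⟩
  · have : w ^ k < (m : ℝ) ^ k := pow_lt_pow_left₀ hm1 (by linarith) hkpos.ne'
    rw [hwk] at this
    exact_mod_cast this
  have hrexp : (r : ℝ) = Real.exp (Real.log r) := (Real.exp_log (by linarith)).symm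
  have h18 : (18 : ℝ) ≤ (r : ℝ) ^ 5 := by
    calc (18 : ℝ) ≤ 2 ^ 5 := by norm_num
      _ ≤ _ := by gcongr
  have hkr : (k : ℝ) ≤ (r : ℝ) ^ k := by
    calc (k : ℝ) ≤ 2 ^ k := by exact_mod_cast Nat.lt_two_pow_self.le
      _ ≤ _ := by gcongr
  have hM : (3 * m * r + 1 : ℝ) ≤ r ^ 4 * w := by
    calc (3 * m * r + 1 : ℝ) ≤ 3 * (2 * w) * r + w * r := by gcongr; nlinarith
      _ ≤ 2 ^ 3 * (w * r) := by nlinarith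
      _ ≤ (r : ℝ) ^ 3 * (w * r) := by gcongr
      _ = _ := by ring
  have h16 : (16 * r ^ 2 : ℝ) ≤ r ^ 6 := by
    calc (16 * r ^ 2 : ℝ) = 2 ^ 4 * r ^ 2 := by norm_num
      _ ≤ (r : ℝ) ^ 4 * r ^ 2 := by gcongr
      _ = _ := by ring
  push_cast
  calc (18 * k * (3 * m * r + 1) ^ (k + 1) * (16 * r ^ 2) ^ k : ℝ)
      ≤ r ^ 5 * r ^ k * (r ^ 4 * w) ^ (k + 1) * (r ^ 6) ^ k := by gcongr
    _ = w ^ k * ((r : ℝ) ^ (11 * k + 9) * w) := by ring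
    _ ≤ w ^ k * ((r : ℝ) ^ (11 * k + 9) * Real.exp t) := by gcongr
    _ = s * Real.exp ((11 * k + 9) * Real.log r + t) := by
      rw [hwk, Real.exp_add]
      congr 2
      conv_lhs => rw [hrexp]
      rw [← Real.exp_nat_mul]
      push_cast
      rfl
    _ ≤ _ := by
      gcongr
      have h1 : (11 * k + 9 : ℝ) ≤ 60 * t := by linarith
      have h2 : t ≤ 2 * Real.log r * t := by nlinarith
      nlinarith [mul_le_mul_of_nonneg_right h1 (by linarith : 0 ≤ Real.log r),
        mul_nonneg (by linarith : 0 ≤ Real.log r) (by linarith : 0 ≤ t)]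

theorem stmt_11 :
    ∃ C : ℝ, 0 < C ∧ ∀ r s : ℕ, 2 ≤ r → r ≤ s →
      (∃ (n : ℕ) (G : SimpleGraph (Fin n)),
        (G.edgeSet.ncard : ℝ) ≤
          (s : ℝ) * Real.exp (C * Real.log r * Real.sqrt (Real.log s)) ∧
        ∀ col : Fin n → Fin n → Bool, HasPath G r col true ∨ HasPath G s col false) ∧
      (orderedSizeRamsey r s : ℝ) ≤
        (s : ℝ) * Real.exp (C * Real.log r * Real.sqrt (Real.log s)) := by
  refine ⟨100, by norm_num, fun r s hr hrs => ?_⟩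
  obtain ⟨m, k, hm, hs, hb⟩ := edge_bound hr (hr.trans hrs)
  obtain ⟨n, G, hG, hcol⟩ := exists_orderedGraph_arrows r s m k (by omega) hm hs
  have hGb := (Nat.cast_le (α := ℝ).2 hG).trans hb
  refine ⟨⟨n, G, hGb, hcol⟩, le_trans ?_ hGb⟩
  exact Nat.cast_le.2 (Nat.sInf_le ⟨n, G, rfl, hcol⟩)
end

section
/- There exists an absolute constant C > 0 such that for all integers n ≥ 2 and q ≥ 2, there exists an ordered graph H with at most C·n^{2q−1}·(log n)³ edges such that every coloring of the edges of H with q colors contains a monotone path with n edges all of whose edges have the same color. Consequently, r̃(P_n; q) ≤ C·n^{2q−1}·(log n)³. -/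
/-- `G` contains a monotone path with `ℓ` edges all of which get the color `c`
under the `q`-coloring `col` of the edges. -/
def HasPathMulti {n q : ℕ} (G : SimpleGraph (Fin n)) (ℓ : ℕ)
    (col : Fin n → Fin n → Fin q) (c : Fin q) : Prop :=
  ∃ v : Fin (ℓ + 1) → Fin n, IsMonoPath G v ∧
    ∀ i : Fin ℓ, col (v i.castSucc) (v i.succ) = c

/-- The `q`-color ordered size Ramsey number `r̃(P_n; q)`. -/
noncomputable def orderedSizeRamseyMulti (n q : ℕ) : ℕ :=
  sInf { m | ∃ (N : ℕ) (G : SimpleGraph (Fin N)), G.edgeSet.ncard = m ∧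
    ∀ col : Fin N → Fin N → Fin q, ∃ c : Fin q, HasPathMulti G n col c }

open Finset

/-- A multi-affine rounding principle: fractional weights hitting a family of sets `B i` well on
average can be rounded to an honest set meeting all the `B i`. -/
lemma exists_rounding {α ι : Type*} [DecidableEq α] [Fintype α] [Fintype ι]
    (B : ι → Finset α) (M : ℝ) (S : Finset α) (x : α → ℝ) (hx : ∀ a, 0 ≤ x a ∧ x a ≤ 1) :
    ∃ y : α → ℝ, (∀ a ∈ S, y a = 0 ∨ y a = 1) ∧ (∀ a, 0 ≤ y a ∧ y a ≤ 1) ∧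
      (∑ i, ∏ a ∈ B i, (1 - y a)) + (∑ a, y a) / M ≤
        (∑ i, ∏ a ∈ B i, (1 - x a)) + (∑ a, x a) / M := by
  induction S using Finset.induction_on with
  | empty => exact ⟨x, by simp, hx, le_rfl⟩
  | insert e S he ih =>
    obtain ⟨y, hyS, hy, hle⟩ := ih
    set F : (α → ℝ) → ℝ := fun z => (∑ i, ∏ a ∈ B i, (1 - z a)) + (∑ a, z a) / M with hF
    have hprod : ∀ (i : ι) (t : ℝ), ∏ a ∈ B i, (1 - Function.update y e t a) =
        (if e ∈ B i then 1 - t else 1) * ∏ a ∈ B i \ {e}, (1 - y a) := by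
      intro i t
      have hrest : ∏ a ∈ B i \ {e}, (1 - Function.update y e t a) =
          ∏ a ∈ B i \ {e}, (1 - y a) := by
        refine Finset.prod_congr rfl fun a ha => ?_
        rw [Function.update_of_ne (by simpa using (Finset.mem_sdiff.1 ha).2)]
      split_ifs with h
      · rw [Finset.prod_eq_mul_prod_sdiff_singleton_of_mem h, hrest, Function.update_self]
      · rw [← hrest, Finset.sdiff_singleton_eq_erase, Finset.erase_eq_of_notMem h, one_mul]
    have haff : F y = (1 - y e) * F (Function.update y e 0) +
        y e * F (Function.update y e 1) := by
      have hself : F y = F (Function.update y e (y e)) := by rw [Function.update_eq_self]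
      have hsum : ∀ t, ∑ a, Function.update y e t a = t + ∑ a ∈ univ \ {e}, y a := fun t =>
        Finset.sum_update_of_mem (mem_univ e) y t
      rw [hself]
      simp only [hF, hprod, hsum]
      have : ∀ i, (if e ∈ B i then 1 - y e else 1) * ∏ a ∈ B i \ {e}, (1 - y a) =
          (1 - y e) * ((if e ∈ B i then 1 - (0:ℝ) else 1) * ∏ a ∈ B i \ {e}, (1 - y a)) +
          y e * ((if e ∈ B i then 1 - (1:ℝ) else 1) * ∏ a ∈ B i \ {e}, (1 - y a)) := by
        intro i
        split_ifs <;> ring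
      rw [Finset.sum_congr rfl fun i _ => this i, Finset.sum_add_distrib, ← Finset.mul_sum,
        ← Finset.mul_sum]
      ring
    obtain ⟨t, ht, htF⟩ : ∃ t : ℝ, (t = 0 ∨ t = 1) ∧ F (Function.update y e t) ≤ F y := by
      by_contra! hcon
      have h0 := hcon 0 (Or.inl rfl)
      have h1 := hcon 1 (Or.inr rfl)
      obtain ⟨hy0, hy1⟩ := hy e
      rcases hy0.eq_or_lt with h | h
      · rw [← h] at haff
        linarith
      · nlinarith
    refine ⟨Function.update y e t, fun a ha => ?_, fun a => ?_, htF.trans hle⟩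
    · rcases eq_or_ne a e with rfl | hne
      · simpa using ht
      · rw [Function.update_of_ne hne]
        exact hyS a (Finset.mem_of_mem_insert_of_ne ha hne)
    · rcases eq_or_ne a e with rfl | hne
      · rcases ht with rfl | rfl <;> simp
      · rw [Function.update_of_ne hne]
        exact hy a

lemma exists_hitting_set {α ι : Type*} [DecidableEq α] [Fintype α] [Fintype ι]
    (B : ι → Finset α) {M : ℝ} (hM : 0 < M) (x : α → ℝ) (hx : ∀ a, 0 ≤ x a ∧ x a ≤ 1)
    (hsum : (∑ i, ∏ a ∈ B i, (1 - x a)) + (∑ a, x a) / M < 1) :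
    ∃ E : Finset α, (E.card : ℝ) ≤ M ∧ ∀ i, ∃ a ∈ E, a ∈ B i := by
  obtain ⟨y, hy, hy01, hle⟩ := exists_rounding B M univ x hx
  have hlt := hle.trans_lt hsum
  have hprod0 : ∀ i, 0 ≤ ∏ a ∈ B i, (1 - y a) := fun i =>
    Finset.prod_nonneg fun a _ => by linarith [(hy01 a).2]
  have hcard : ((univ.filter fun a => y a = 1).card : ℝ) = ∑ a, y a := by
    rw [Finset.card_filter]
    push_cast
    refine Finset.sum_congr rfl fun a _ => ?_
    rcases hy a (mem_univ a) with h | h <;> simp [h]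
  have hy0 : 0 ≤ ∑ a, y a := Finset.sum_nonneg fun a _ => (hy01 a).1
  refine ⟨univ.filter fun a => y a = 1, ?_, fun i => ?_⟩
  · rw [hcard]
    have := Finset.sum_nonneg fun i (_ : i ∈ univ) => hprod0 i
    exact ((div_lt_one hM).1 (by linarith)).le
  · by_contra! hcon
    have h1 : ∏ a ∈ B i, (1 - y a) = 1 := by
      refine Finset.prod_eq_one fun a ha => ?_
      rcases hy a (mem_univ a) with h | h
      · simp [h]
      · exact absurd ha (hcon a (by simp [h]))
    have h2 := Finset.single_le_sum (fun i (_ : i ∈ univ) => hprod0 i) (mem_univ i)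
    have := div_nonneg hy0 hM.le
    linarith

lemma exists_balanced_value {β γ : Type*} (L : Finset β) (R : Finset γ) (g : β → ℕ) (h : γ → ℕ)
    {lo hi : ℕ} (hlo : lo ≤ hi) (hL : ∀ a ∈ L, g a ≤ hi) (hR : ∀ a ∈ R, lo ≤ h a) :
    ∃ m, lo ≤ m ∧ m ≤ hi ∧
      (L.filter fun a => m < g a).card ≤ (R.filter fun a => h a ≤ m).card ∧
      (R.filter fun a => h a < m).card ≤ (L.filter fun a => m ≤ g a).card := by
  classical
  have hex : ∃ m, lo ≤ m ∧
      (L.filter fun a => m < g a).card ≤ (R.filter fun a => h a ≤ m).card := by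
    refine ⟨hi, hlo, ?_⟩
    rw [Finset.filter_false_of_mem fun a ha => not_lt.2 (hL a ha)]
    simp
  refine ⟨Nat.find hex, (Nat.find_spec hex).1, Nat.find_min' hex ⟨hlo, ?_⟩,
    (Nat.find_spec hex).2, ?_⟩
  · rw [Finset.filter_false_of_mem fun a ha => not_lt.2 (hL a ha)]
    simp
  · rcases (Nat.find_spec hex).1.eq_or_lt with heq | hlt
    · rw [← heq, Finset.filter_false_of_mem fun a ha => not_lt.2 (hR a ha)]
      simp
    · have hmin := Nat.find_min hex (m := Nat.find hex - 1) (by omega)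
      push Not at hmin
      have h1 := hmin (by omega)
      have e1 : ∀ a, Nat.find hex - 1 < g a ↔ Nat.find hex ≤ g a := fun a => by omega
      have e2 : ∀ a, h a ≤ Nat.find hex - 1 ↔ h a < Nat.find hex := fun a => by omega
      simp only [e1, e2] at h1
      exact h1.le

/-- The pairs of `A` inverted by `g`. -/
def inversions {N : ℕ} (g : Fin N → ℕ) (A : Finset (Fin N)) : Finset (Fin N × Fin N) :=
  (A ×ˢ A).filter fun x => x.1 < x.2 ∧ g x.2 < g x.1

lemma card_mul_card_le_sum {N : ℕ} (p : Fin N → Fin N → ℝ) {c : ℝ}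
    (X Y : Finset (Fin N)) (h : ∀ u ∈ X, ∀ v ∈ Y, c ≤ p u v) :
    c * ((X.card : ℝ) * Y.card) ≤ ∑ x ∈ X ×ˢ Y, p x.1 x.2 := by
  have := Finset.card_nsmul_le_sum (X ×ˢ Y) (fun x => p x.1 x.2) c fun x hx =>
    h _ (Finset.mem_product.1 hx).1 _ (Finset.mem_product.1 hx).2
  rw [Finset.card_product, nsmul_eq_mul] at this
  push_cast at this
  linarith

lemma card_le_of_inversions {N r T : ℕ} (p : Fin N → Fin N → ℝ) (hp0 : ∀ u v, 0 ≤ p u v)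
    (hp : ∀ k ≤ T, ∀ u v : Fin N, (u : ℕ) / (r * 2 ^ k) = v / (r * 2 ^ k) →
      (1 / 2 : ℝ) ^ k ≤ p u v)
    (g : Fin N → ℕ) {μ : ℝ} (hμ : 0 < μ) (k : ℕ) (hk : k ≤ T) (t lo hi : ℕ) (hlo : lo ≤ hi)
    (A : Finset (Fin N)) (hA : ∀ a ∈ A, (a : ℕ) / (r * 2 ^ k) = t)
    (hg : ∀ a ∈ A, lo ≤ g a ∧ g a ≤ hi)
    (hleaf : ∀ u ∈ A, ∀ v ∈ A, u < v → (u : ℕ) / r = v / r → g u < g v) :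
    (A.card : ℝ) ≤ ((hi : ℝ) - lo + 1) + (2 ^ k - 1) +
      2 * μ * ∑ x ∈ inversions g A, p x.1 x.2 + k * 2 ^ k / (2 * μ) := by
  induction k generalizing t lo hi A with
  | zero =>
    have hinj : Set.InjOn g A := by
      intro u hu v hv huv
      have hdiv : (u : ℕ) / r = v / r := by
        have h1 := hA u hu
        have h2 := hA v hv
        simp only [pow_zero, mul_one] at h1 h2
        rw [h1, h2]
      rcases lt_trichotomy u v with h | h | h
      · exact absurd huv (hleaf u hu v hv h hdiv).ne
      · exact h
      · exact absurd huv (hleaf v hv u hu h hdiv.symm).ne'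
    have hcard := Finset.card_le_card_of_injOn (t := Finset.Icc lo hi) g
      (fun a ha => by simpa using hg a ha) hinj
    rw [Nat.card_Icc] at hcard
    have h1 : (A.card : ℝ) + lo ≤ hi + 1 := by
      have : A.card + lo ≤ hi + 1 := by omega
      exact_mod_cast this
    have h2 : 0 ≤ 2 * μ * ∑ x ∈ inversions g A, p x.1 x.2 :=
      mul_nonneg (by positivity) (Finset.sum_nonneg fun x _ => hp0 _ _)
    simp only [pow_zero, CharP.cast_eq_zero, zero_mul, zero_div]
    linarith
  | succ k ih =>
    have hchild : ∀ a ∈ A, (a : ℕ) / (r * 2 ^ k) = 2 * t ∨ (a : ℕ) / (r * 2 ^ k) = 2 * t + 1 := by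
      intro a ha
      have := hA a ha
      rw [pow_succ, ← mul_assoc, ← Nat.div_div_eq_div_mul] at this
      omega
    set L := A.filter fun a : Fin N => (a : ℕ) / (r * 2 ^ k) = 2 * t with hLdef
    set R := A.filter fun a : Fin N => (a : ℕ) / (r * 2 ^ k) = 2 * t + 1 with hRdef
    have hLA : L ⊆ A := Finset.filter_subset _ _
    have hRA : R ⊆ A := Finset.filter_subset _ _
    have hLR : ∀ u ∈ L, ∀ v ∈ R, u < v := by
      intro u hu v hv
      by_contra! hvu
      have h1 : (v : ℕ) / (r * 2 ^ k) ≤ u / (r * 2 ^ k) := Nat.div_le_div_right hvu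
      rw [(Finset.mem_filter.1 hu).2, (Finset.mem_filter.1 hv).2] at h1
      omega
    have hcardA : A.card = L.card + R.card := by
      have := Finset.card_filter_add_card_filter_not (s := A)
        (fun a : Fin N => (a : ℕ) / (r * 2 ^ k) = 2 * t)
      rw [← this]
      congr 2
      refine Finset.filter_congr fun a ha => ?_
      have := hchild a ha
      omega
    obtain ⟨m, hm1, hm2, hc1, hc2⟩ := exists_balanced_value L R g g hlo
      (fun a ha => (hg a (hLA ha)).2) (fun a ha => (hg a (hRA ha)).1)
    set L₁ := L.filter fun a => m < g a with hL₁
    set L₂ := L.filter fun a => m ≤ g a with hL₂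
    set L₀ := L.filter fun a => g a ≤ m with hL₀
    set R₁ := R.filter fun a => g a < m with hR₁
    set R₂ := R.filter fun a => g a ≤ m with hR₂
    set R₀ := R.filter fun a => m ≤ g a with hR₀
    have hLcard : L.card = L₀.card + L₁.card := by
      rw [← Finset.card_filter_add_card_filter_not (s := L) (fun a => g a ≤ m)]
      simp only [hL₀, hL₁, not_le]
    have hRcard : R.card = R₁.card + R₀.card := by
      rw [← Finset.card_filter_add_card_filter_not (s := R) (fun a => g a < m)]
      simp only [hR₀, hR₁, not_lt]
    have hL₀L : L₀ ⊆ L := Finset.filter_subset _ _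
    have hR₀R : R₀ ⊆ R := Finset.filter_subset _ _
    have ihL := ih (by omega) (2 * t) lo m hm1 L₀
      (fun a ha => (Finset.mem_filter.1 (hL₀L ha)).2)
      (fun a ha => ⟨(hg a (hLA (hL₀L ha))).1, (Finset.mem_filter.1 ha).2⟩)
      (fun u hu v hv => hleaf u (hLA (hL₀L hu)) v (hLA (hL₀L hv)))
    have ihR := ih (by omega) (2 * t + 1) m hi hm2 R₀
      (fun a ha => (Finset.mem_filter.1 (hR₀R ha)).2)
      (fun a ha => ⟨(Finset.mem_filter.1 ha).2, (hg a (hRA (hR₀R ha))).2⟩)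
      (fun u hu v hv => hleaf u (hRA (hR₀R hu)) v (hRA (hR₀R hv)))
    set cross := (inversions g A).filter fun x => x.1 ∈ L ∧ x.2 ∈ R with hcross
    have hdisj : Disjoint L R := by
      rw [Finset.disjoint_left]
      intro a h1 h2
      exact (hLR a h1 a h2).false
    have hsplit : ∑ x ∈ inversions g L₀, p x.1 x.2 + ∑ x ∈ inversions g R₀, p x.1 x.2 +
        ∑ x ∈ cross, p x.1 x.2 ≤ ∑ x ∈ inversions g A, p x.1 x.2 := by
      have d1 : Disjoint (inversions g L₀) (inversions g R₀) := by
        rw [Finset.disjoint_left]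
        intro x h1 h2
        simp only [inversions, Finset.mem_filter, Finset.mem_product] at h1 h2
        exact Finset.disjoint_left.1 hdisj (hL₀L h1.1.1) (hR₀R h2.1.1)
      have d2 : Disjoint (inversions g L₀ ∪ inversions g R₀) cross := by
        rw [Finset.disjoint_left]
        intro x h1 h2
        simp only [hcross, inversions, Finset.mem_filter, Finset.mem_product,
          Finset.mem_union] at h1 h2
        rcases h1 with h1 | h1
        · exact Finset.disjoint_left.1 hdisj (hL₀L h1.1.2) h2.2.2
        · exact Finset.disjoint_left.1 hdisj h2.2.1 (hR₀R h1.1.1)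
      rw [← Finset.sum_union d1, ← Finset.sum_union d2]
      refine Finset.sum_le_sum_of_subset_of_nonneg ?_ fun x _ _ => hp0 _ _
      refine Finset.union_subset (Finset.union_subset ?_ ?_) (Finset.filter_subset _ _)
      · exact Finset.filter_subset_filter _ (Finset.product_subset_product
          (hL₀L.trans hLA) (hL₀L.trans hLA))
      · exact Finset.filter_subset_filter _ (Finset.product_subset_product
          (hR₀R.trans hRA) (hR₀R.trans hRA))
    have hcrossge : ∀ X Y : Finset (Fin N), X ⊆ L → Y ⊆ R → (∀ u ∈ X, ∀ v ∈ Y, g v < g u) →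
        (1 / 2 : ℝ) ^ (k + 1) * ((X.card : ℝ) * Y.card) ≤ ∑ x ∈ cross, p x.1 x.2 := by
      intro X Y hX hY hXY
      refine (card_mul_card_le_sum p X Y fun u hu v hv => hp (k + 1) hk u v ?_).trans ?_
      · rw [hA u (hLA (hX hu)), hA v (hRA (hY hv))]
      · refine Finset.sum_le_sum_of_subset_of_nonneg ?_ fun x _ _ => hp0 _ _
        intro x hx
        obtain ⟨h1, h2⟩ := Finset.mem_product.1 hx
        simp only [hcross, inversions, Finset.mem_filter, Finset.mem_product]
        exact ⟨⟨⟨hLA (hX h1), hRA (hY h2)⟩, hLR _ (hX h1) _ (hY h2), hXY _ h1 _ h2⟩,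
          hX h1, hY h2⟩
    have w1 := hcrossge L₁ R₂ (Finset.filter_subset _ _) (Finset.filter_subset _ _)
      fun u hu v hv => (Finset.mem_filter.1 hv).2.trans_lt (Finset.mem_filter.1 hu).2
    have w2 := hcrossge L₂ R₁ (Finset.filter_subset _ _) (Finset.filter_subset _ _)
      fun u hu v hv => (Finset.mem_filter.1 hv).2.trans_le (Finset.mem_filter.1 hu).2
    set ε : ℝ := (1 / 2 : ℝ) ^ (k + 1) with hε
    have hε0 : 0 < ε := by positivity
    set W := ∑ x ∈ cross, p x.1 x.2
    have hc1' : (L₁.card : ℝ) ≤ R₂.card := by exact_mod_cast hc1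
    have hc2' : (R₁.card : ℝ) ≤ L₂.card := by exact_mod_cast hc2
    have v1 : ε * (L₁.card : ℝ) ^ 2 ≤ W := by
      refine le_trans (mul_le_mul_of_nonneg_left ?_ hε0.le) w1
      rw [sq]
      exact mul_le_mul_of_nonneg_left hc1' (by positivity)
    have v2 : ε * (R₁.card : ℝ) ^ 2 ≤ W := by
      refine le_trans (mul_le_mul_of_nonneg_left ?_ hε0.le) w2
      rw [sq]
      exact mul_le_mul_of_nonneg_right hc2' (by positivity)
    have hinv : (2 : ℝ) ^ (k + 1) * ε = 1 := by
      rw [hε, ← mul_pow]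
      norm_num
    have amgm : ∀ a : ℝ, ε * a ^ 2 ≤ W → a ≤ μ * W + 2 ^ (k + 1) / (4 * μ) := by
      intro a ha
      have h1 : a ≤ μ * (ε * a ^ 2) + 2 ^ (k + 1) / (4 * μ) := by
        have h2 : μ * (ε * a ^ 2) + 2 ^ (k + 1) / (4 * μ) - a =
            ε * μ * (a - 2 ^ (k + 1) / (2 * μ)) ^ 2 := by
          have : ε = 1 / 2 ^ (k + 1) := by field_simp; linarith
          rw [this]
          field_simp
          ring
        have h3 : 0 ≤ ε * μ * (a - 2 ^ (k + 1) / (2 * μ)) ^ 2 := by positivity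
        linarith
      have := mul_le_mul_of_nonneg_left ha hμ.le
      linarith
    have a1 := amgm _ v1
    have a2 := amgm _ v2
    have hs := mul_le_mul_of_nonneg_left hsplit (by positivity : 0 ≤ 2 * μ)
    have hcardR : (A.card : ℝ) = L₀.card + L₁.card + (R₁.card + R₀.card) := by
      rw [hcardA, hLcard, hRcard]
      push_cast
      ring
    have e1 : (2 : ℝ) ^ (k + 1) / (4 * μ) + 2 ^ (k + 1) / (4 * μ) + (k * 2 ^ k / (2 * μ) +
        k * 2 ^ k / (2 * μ)) = ((k + 1 : ℕ) : ℝ) * 2 ^ (k + 1) / (2 * μ) := by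
      push_cast
      field_simp
      ring
    have e2 : (2 : ℝ) ^ (k + 1) = 2 ^ k + 2 ^ k := by ring
    rw [hcardR, ← e1]
    linarith

/-- The pairs of vertices inverted by the labelling `f` in direction `j`, along a line of the
grid. -/
def lineInversions {N n q : ℕ} (f : Fin N → Fin q → Fin n) (j : Fin q) :
    Finset (Fin N × Fin N) :=
  univ.filter fun x => x.1 < x.2 ∧ f x.2 j < f x.1 j ∧ ∀ i, i ≠ j → f x.1 i = f x.2 i

/-- The pairs of vertices on which the labelling `f` is weakly decreasing. -/
def descents {N n q : ℕ} (f : Fin N → Fin q → Fin n) : Finset (Fin N × Fin N) :=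
  univ.filter fun x => x.1 < x.2 ∧ ∀ i, f x.2 i ≤ f x.1 i

lemma card_le_of_lineInversions {N n q r T : ℕ} (hn : 1 ≤ n) (hN : N ≤ r * 2 ^ T)
    (p : Fin N → Fin N → ℝ) (hp0 : ∀ u v, 0 ≤ p u v)
    (hp : ∀ k ≤ T, ∀ u v : Fin N, (u : ℕ) / (r * 2 ^ k) = v / (r * 2 ^ k) →
      (1 / 2 : ℝ) ^ k ≤ p u v)
    (f : Fin N → Fin q → Fin n)
    (hleaf : ∀ u v : Fin N, u < v → (u : ℕ) / r = v / r → ∃ i, f u i < f v i)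
    {μ : ℝ} (hμ : 0 < μ) (j : Fin q) :
    (N : ℝ) ≤ (n : ℝ) ^ (q - 1) * (n + (2 ^ T - 1) + T * 2 ^ T / (2 * μ)) +
      2 * μ * ∑ x ∈ lineInversions f j, p x.1 x.2 := by
  classical
  let line : Fin N → ({i // i ≠ j} → Fin n) := fun v i => f v i
  have hfib : ∀ c : {i // i ≠ j} → Fin n,
      ((univ.filter fun v => line v = c).card : ℝ) ≤ (n + (2 ^ T - 1) + T * 2 ^ T / (2 * μ)) +
        2 * μ * ∑ x ∈ (lineInversions f j).filter (fun x => line x.1 = c), p x.1 x.2 := by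
    intro c
    have key := card_le_of_inversions p hp0 hp (fun v => (f v j : ℕ)) hμ T le_rfl 0 0 (n - 1)
      (Nat.zero_le _) (univ.filter fun v => line v = c)
      (fun a _ => Nat.div_eq_of_lt (a.2.trans_le hN))
      (fun a _ => ⟨Nat.zero_le _, by have := (f a j).2; omega⟩)
      (fun u hu v hv huv hdiv => by
        obtain ⟨i, hi⟩ := hleaf u v huv hdiv
        have heq : line u = line v :=
          (Finset.mem_filter.1 hu).2.trans (Finset.mem_filter.1 hv).2.symm
        by_cases hij : i = j
        · subst hij
          exact hi
        · exact absurd (congrFun heq ⟨i, hij⟩) hi.ne)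
    have hset : inversions (fun v => (f v j : ℕ)) (univ.filter fun v => line v = c) =
        (lineInversions f j).filter (fun x => line x.1 = c) := by
      ext x
      simp only [inversions, lineInversions, Finset.mem_filter, Finset.mem_product,
        Finset.mem_univ, true_and, Fin.val_fin_lt]
      constructor
      · rintro ⟨⟨h1, h2⟩, h3, h4⟩
        exact ⟨⟨h3, h4, fun i hi => congrFun (h1.trans h2.symm) ⟨i, hi⟩⟩, h1⟩
      · rintro ⟨⟨h3, h4, h5⟩, h1⟩
        refine ⟨⟨h1, ?_⟩, h3, h4⟩
        rw [← h1]
        funext i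
        exact (h5 i i.2).symm
    rw [hset, Nat.cast_sub hn] at key
    push_cast at key
    linarith
  have hcard : (N : ℝ) = ∑ c : {i // i ≠ j} → Fin n,
      ((univ.filter fun v => line v = c).card : ℝ) := by
    have := Finset.card_eq_sum_card_fiberwise (f := line) (s := univ) (t := univ) (by simp)
    rw [Finset.card_univ, Fintype.card_fin] at this
    exact_mod_cast this
  have hlines : (Fintype.card ({i // i ≠ j} → Fin n) : ℝ) = (n : ℝ) ^ (q - 1) := by
    rw [Fintype.card_fun, Fintype.card_fin, Fintype.card_subtype_compl, Fintype.card_fin,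
      Fintype.card_subtype_eq]
    push_cast
    rfl
  calc (N : ℝ) ≤ ∑ c : {i // i ≠ j} → Fin n, ((n + (2 ^ T - 1) + T * 2 ^ T / (2 * μ)) +
        2 * μ * ∑ x ∈ (lineInversions f j).filter (fun x => line x.1 = c), p x.1 x.2) := by
        rw [hcard]
        exact Finset.sum_le_sum fun c _ => hfib c
    _ = _ := by
        rw [Finset.sum_add_distrib, ← Finset.mul_sum,
          Finset.sum_fiberwise (lineInversions f j) (fun x => line x.1) (fun x => p x.1 x.2),
          Finset.sum_const, Finset.card_univ, nsmul_eq_mul, hlines]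

lemma sum_lineInversions_le {N n q : ℕ} (p : Fin N → Fin N → ℝ) (hp0 : ∀ u v, 0 ≤ p u v)
    (f : Fin N → Fin q → Fin n) :
    ∑ j, ∑ x ∈ lineInversions f j, p x.1 x.2 ≤ ∑ x ∈ descents f, p x.1 x.2 := by
  classical
  rw [← Finset.sum_biUnion]
  · refine Finset.sum_le_sum_of_subset_of_nonneg ?_ fun x _ _ => hp0 _ _
    intro x hx
    simp only [Finset.mem_biUnion, lineInversions, Finset.mem_filter, Finset.mem_univ,
      true_and] at hx
    obtain ⟨j, h1, h2, h3⟩ := hx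
    simp only [descents, Finset.mem_filter, Finset.mem_univ, true_and]
    refine ⟨h1, fun i => ?_⟩
    rcases eq_or_ne i j with rfl | hij
    · exact h2.le
    · exact (h3 i hij).ge
  · intro j _ j' _ hjj'
    refine Finset.disjoint_left.2 fun x hx hx' => ?_
    simp only [lineInversions, Finset.mem_filter, Finset.mem_univ, true_and] at hx hx'
    exact hx.2.1.ne (hx'.2.2 j hjj').symm

lemma prod_descents_le {n q r T : ℕ} (hn : 2 ≤ n) (hq : 1 ≤ q) (hN : 4 * n ^ q ≤ r * 2 ^ T)
    (hT : 2 ^ T ≤ n) (hT' : 8 * (T * 2 ^ T) * Real.log n ≤ n)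
    (p : Fin (4 * n ^ q) → Fin (4 * n ^ q) → ℝ) (hp0 : ∀ u v, 0 ≤ p u v)
    (hp1 : ∀ u v, p u v ≤ 1)
    (hp : ∀ k ≤ T, ∀ u v : Fin (4 * n ^ q), (u : ℕ) / (r * 2 ^ k) = v / (r * 2 ^ k) →
      (1 / 2 : ℝ) ^ k ≤ p u v)
    (f : Fin (4 * n ^ q) → Fin q → Fin n) :
    ∏ x ∈ descents f, (1 - p x.1 x.2) ≤ Real.exp (-(8 * q * n ^ q * Real.log n)) := by
  by_cases hone : ∃ x ∈ descents f, p x.1 x.2 = 1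
  · obtain ⟨x, hx, hx1⟩ := hone
    rw [Finset.prod_eq_zero hx (by linarith)]
    exact (Real.exp_pos _).le
  · push Not at hone
    have hleaf : ∀ u v : Fin (4 * n ^ q), u < v → (u : ℕ) / r = v / r → ∃ i, f u i < f v i := by
      intro u v huv hdiv
      by_contra! hcon
      refine hone (u, v) (by simp [descents, huv, hcon]) (le_antisymm (hp1 _ _) ?_)
      have := hp 0 (Nat.zero_le _) u v (by simpa using hdiv)
      simpa using this
    have hlog : 0 < Real.log n := Real.log_pos (by exact_mod_cast hn)
    have hT2 : (2 : ℝ) ^ T ≤ n := by exact_mod_cast hT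
    have hpow : (n : ℝ) ^ q = n ^ (q - 1) * n := by
      rw [← pow_succ, Nat.sub_add_cancel hq]
    have hdir : ∀ j, 8 * n ^ q * Real.log n ≤ ∑ x ∈ lineInversions f j, p x.1 x.2 := by
      intro j
      have h := card_le_of_lineInversions (by omega) hN p hp0 hp f hleaf
        (μ := 1 / (16 * Real.log n)) (by positivity) j
      have e1 : (T : ℝ) * 2 ^ T / (2 * (1 / (16 * Real.log n))) =
          8 * (T * 2 ^ T) * Real.log n := by
        field_simp
        ring
      rw [e1] at h
      have h2 : (n : ℝ) ^ (q - 1) * (n + (2 ^ T - 1) + 8 * (T * 2 ^ T) * Real.log n) ≤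
          n ^ (q - 1) * (3 * n) :=
        mul_le_mul_of_nonneg_left (by linarith) (by positivity)
      push_cast at h
      set S := ∑ x ∈ lineInversions f j, p x.1 x.2
      have h3 : (n : ℝ) ^ q ≤ 2 * (1 / (16 * Real.log n)) * S := by
        rw [hpow] at h ⊢
        linarith
      have h4 : 2 * (1 / (16 * Real.log n)) * S = S / (8 * Real.log n) := by
        field_simp
        ring
      rw [h4, le_div_iff₀ (by positivity)] at h3
      linarith
    have hsum : 8 * q * n ^ q * Real.log n ≤ ∑ x ∈ descents f, p x.1 x.2 := by
      refine le_trans ?_ (sum_lineInversions_le p hp0 f)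
      have := Finset.sum_le_sum fun j (_ : j ∈ univ) => hdir j
      rw [Finset.sum_const, Finset.card_univ, Fintype.card_fin, nsmul_eq_mul] at this
      linarith
    calc ∏ x ∈ descents f, (1 - p x.1 x.2) ≤ ∏ x ∈ descents f, Real.exp (-p x.1 x.2) := by
          refine Finset.prod_le_prod (fun x _ => by linarith [hp1 x.1 x.2]) fun x _ => ?_
          linarith [Real.add_one_le_exp (-p x.1 x.2)]
      _ = Real.exp (-∑ x ∈ descents f, p x.1 x.2) := by
          rw [← Real.exp_sum, Finset.sum_neg_distrib]
      _ ≤ _ := Real.exp_le_exp.2 (neg_le_neg hsum)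

/-- Hierarchical edge density: about `2⁻ᵏ` for two vertices whose smallest common dyadic block
consists of `2ᵏ` elementary blocks of length `r`. -/
noncomputable def blockDensity {N : ℕ} (r T : ℕ) (u v : Fin N) : ℝ :=
  min 1 (∑ k ∈ range (T + 1),
    if (u : ℕ) / (r * 2 ^ k) = v / (r * 2 ^ k) then (1 / 2 : ℝ) ^ k else 0)

lemma blockDensity_nonneg {N : ℕ} (r T : ℕ) (u v : Fin N) : 0 ≤ blockDensity r T u v :=
  le_min zero_le_one (Finset.sum_nonneg fun k _ => by split_ifs <;> positivity)

lemma blockDensity_le_one {N : ℕ} (r T : ℕ) (u v : Fin N) : blockDensity r T u v ≤ 1 :=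
  min_le_left _ _

lemma le_blockDensity {N r T k : ℕ} (hk : k ≤ T) {u v : Fin N}
    (h : (u : ℕ) / (r * 2 ^ k) = v / (r * 2 ^ k)) : (1 / 2 : ℝ) ^ k ≤ blockDensity r T u v := by
  refine le_min (pow_le_one₀ (by norm_num) (by norm_num)) ?_
  have := Finset.single_le_sum (s := range (T + 1)) (f := fun k =>
    if (u : ℕ) / (r * 2 ^ k) = v / (r * 2 ^ k) then (1 / 2 : ℝ) ^ k else 0)
    (fun k _ => by split_ifs <;> positivity) (Finset.mem_range.2 (Nat.lt_succ_of_le hk))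
  simpa [h] using this

lemma card_filter_div_eq_le {N s : ℕ} (hs : 0 < s) (c : ℕ) :
    (univ.filter fun v : Fin N => c = (v : ℕ) / s).card ≤ s := by
  have h := Finset.card_le_card_of_injOn (s := univ.filter fun v : Fin N => c = (v : ℕ) / s)
    (t := Finset.Ico (c * s) (c * s + s)) (fun v => (v : ℕ)) (fun v hv => by
      have hv' : c = (v : ℕ) / s := by simpa using hv
      have h1 := Nat.div_add_mod (v : ℕ) s
      have h2 := Nat.mod_lt (v : ℕ) hs
      rw [← hv', mul_comm] at h1
      simp only [Finset.coe_Ico, Set.mem_Ico]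
      omega) (Fin.val_injective.injOn)
  simpa using h

lemma sum_blockDensity_le {N r : ℕ} (hr : 0 < r) (T : ℕ) :
    ∑ x : Fin N × Fin N, blockDensity r T x.1 x.2 ≤ N * r * (T + 1) := by
  rw [Fintype.sum_prod_type]
  have hrow : ∀ u : Fin N, ∑ v, blockDensity r T u v ≤ r * (T + 1) := by
    intro u
    calc ∑ v, blockDensity r T u v ≤ ∑ v : Fin N, ∑ k ∈ range (T + 1),
          (if (u : ℕ) / (r * 2 ^ k) = v / (r * 2 ^ k) then (1 / 2 : ℝ) ^ k else 0) :=
          Finset.sum_le_sum fun v _ => min_le_right _ _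
      _ = ∑ k ∈ range (T + 1), ((univ.filter fun v : Fin N =>
            (u : ℕ) / (r * 2 ^ k) = v / (r * 2 ^ k)).card : ℝ) * (1 / 2 : ℝ) ^ k := by
          rw [Finset.sum_comm]
          refine Finset.sum_congr rfl fun k _ => ?_
          rw [← Finset.sum_filter, Finset.sum_const, nsmul_eq_mul]
      _ ≤ ∑ k ∈ range (T + 1), (r : ℝ) := by
          refine Finset.sum_le_sum fun k _ => ?_
          have h : ((univ.filter fun v : Fin N =>
              (u : ℕ) / (r * 2 ^ k) = v / (r * 2 ^ k)).card : ℝ) ≤ r * 2 ^ k := by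
            exact_mod_cast card_filter_div_eq_le (N := N) (by positivity : 0 < r * 2 ^ k) _
          refine (mul_le_mul_of_nonneg_right h (by positivity)).trans_eq ?_
          rw [mul_assoc, ← mul_pow]
          norm_num
      _ = r * (T + 1) := by
          rw [Finset.sum_const, Finset.card_range, nsmul_eq_mul]
          push_cast
          ring
  refine (Finset.sum_le_sum fun u _ => hrow u).trans_eq ?_
  rw [Finset.sum_const, Finset.card_univ, Fintype.card_fin, nsmul_eq_mul]
  ring

lemma exists_edges_meeting_descents {n q T : ℕ} (hn : 2 ≤ n) (hq : 1 ≤ q) (hT : 2 ^ T ≤ n)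
    (hT' : 8 * (T * 2 ^ T) * Real.log n ≤ n) :
    ∃ E : Finset (Fin (4 * n ^ q) × Fin (4 * n ^ q)),
      (E.card : ℝ) ≤ 64 * n ^ (2 * q) * ((T + 1) / 2 ^ T) ∧
      ∀ f : Fin (4 * n ^ q) → Fin q → Fin n, ∃ x ∈ E, x ∈ descents f := by
  set N := 4 * n ^ q with hNdef
  have hn0 : 0 < n := by omega
  have hNpos : 0 < N := by positivity
  set r := N / 2 ^ T + 1 with hr
  have hrpos : 0 < r := Nat.succ_pos _
  have hNr : N ≤ r * 2 ^ T := by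
    have := Nat.lt_div_mul_add (a := N) (b := 2 ^ T) (by positivity)
    rw [hr, add_mul]
    omega
  have hrN : r * 2 ^ T ≤ 2 * N := by
    have h1 := Nat.div_mul_le_self N (2 ^ T)
    have h2 : n ≤ n ^ q := Nat.le_self_pow (by omega) n
    rw [hr, add_mul]
    omega
  set M : ℝ := 2 * (N * r * (T + 1)) with hM
  have hMpos : 0 < M := by positivity
  obtain ⟨E, hE, hhit⟩ := exists_hitting_set
    (fun f : Fin N → Fin q → Fin n => descents f) hMpos
    (fun x => blockDensity r T x.1 x.2)
    (fun x => ⟨blockDensity_nonneg _ _ _ _, blockDensity_le_one _ _ _ _⟩) (by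
      have hlog : 0.69 < Real.log n :=
        (by linarith [Real.log_two_gt_d9] : 0.69 < Real.log 2).trans_le
          (Real.log_le_log (by norm_num) (by exact_mod_cast hn))
      have h1 : ∑ f : Fin N → Fin q → Fin n,
          ∏ x ∈ descents f, (1 - blockDensity r T x.1 x.2) < 1 / 2 := by
        have h2 := Finset.sum_le_sum fun (f : Fin N → Fin q → Fin n) (_ : f ∈ univ) =>
          prod_descents_le hn hq hNr hT hT' (blockDensity r T) (blockDensity_nonneg r T)
            (blockDensity_le_one r T) (fun k hk u v h => le_blockDensity hk h) f
        rw [Finset.sum_const, Finset.card_univ, nsmul_eq_mul] at h2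
        refine h2.trans_lt ?_
        have hcard : (Fintype.card (Fin N → Fin q → Fin n) : ℝ) =
            Real.exp (4 * q * n ^ q * Real.log n) := by
          have hn' : (0 : ℝ) < n := by exact_mod_cast hn0
          simp only [Fintype.card_fun, Fintype.card_fin]
          push_cast
          rw [← pow_mul, ← Real.exp_log hn', ← Real.exp_nat_mul, Real.exp_log hn', hNdef]
          push_cast
          ring_nf
        rw [hcard, ← Real.exp_add]
        have h3 : (1 : ℝ) ≤ n ^ q := one_le_pow₀ (by exact_mod_cast hn0)
        have h4 : (1 : ℝ) ≤ q := by exact_mod_cast hq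
        have h5 : (1 : ℝ) ≤ q * n ^ q := one_le_mul_of_one_le_of_one_le h4 h3
        have h6 : Real.log n ≤ q * n ^ q * Real.log n := le_mul_of_one_le_left (by linarith) h5
        have h7 : (1 / 2 : ℝ) = Real.exp (-Real.log 2) := by
          rw [Real.exp_neg, Real.exp_log (by norm_num)]
          norm_num
        rw [h7]
        refine Real.exp_lt_exp.2 ?_
        have := Real.log_two_lt_d9
        linarith
      have h8 : (∑ x : Fin N × Fin N, blockDensity r T x.1 x.2) / M ≤ 1 / 2 := by
        rw [div_le_iff₀ hMpos, hM]
        linarith [sum_blockDensity_le (N := N) hrpos T]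
      linarith)
  refine ⟨E, hE.trans ?_, hhit⟩
  have hrN' : (r : ℝ) * 2 ^ T ≤ 2 * N := by exact_mod_cast hrN
  have hr' : (r : ℝ) ≤ 2 * N / 2 ^ T := by rwa [le_div_iff₀ (by positivity)]
  have hNc : (N : ℝ) = 4 * n ^ q := by rw [hNdef]; push_cast; rfl
  calc M = (2 * N * (T + 1)) * r := by rw [hM]; ring
    _ ≤ (2 * N * (T + 1)) * (2 * N / 2 ^ T) := mul_le_mul_of_nonneg_left hr' (by positivity)
    _ = _ := by
      rw [hNc]
      ring

lemma exists_scale {n : ℕ} (hn : 2 ≤ n) :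
    ∃ T : ℕ, 2 ^ T ≤ n ∧ 8 * (T * 2 ^ T) * Real.log n ≤ n ∧
      n * (((T : ℝ) + 1) / 2 ^ T) ≤ 128 * Real.log n ^ 3 := by
  have hlog2 := Real.log_two_gt_d9
  have hn2 : (2 : ℝ) ≤ n := by exact_mod_cast hn
  have hlog : 0.69 < Real.log n :=
    (by linarith : 0.69 < Real.log 2).trans_le (Real.log_le_log (by norm_num) hn2)
  set l := Real.log n with hl
  have hl0 : 0 < l := by linarith
  rcases lt_or_ge (n : ℝ) (16 * l ^ 2) with hsmall | hlarge
  · refine ⟨0, by simp; omega, by simp, ?_⟩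
    have : 16 * l ^ 2 ≤ 128 * l ^ 3 := by nlinarith [sq_nonneg l]
    simp
    linarith
  · have hx : 1 ≤ (n : ℝ) / (16 * l ^ 2) := by rwa [le_div_iff₀ (by positivity), one_mul]
    obtain ⟨T, hT1, hT2⟩ := exists_nat_pow_near hx (by norm_num : (1 : ℝ) < 2)
    rw [le_div_iff₀ (by positivity)] at hT1
    rw [div_lt_iff₀ (by positivity)] at hT2
    have hpow : (0 : ℝ) < 2 ^ T := by positivity
    have h16 : 1 ≤ 16 * l ^ 2 := by nlinarith
    have hTn : (2 : ℝ) ^ T ≤ n := (le_mul_of_one_le_right hpow.le h16).trans hT1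
    have hTl : (T : ℝ) ≤ 2 * l := by
      have := Real.log_le_log hpow hTn
      rw [Real.log_pow, ← hl] at this
      have h0 : (0 : ℝ) ≤ T := Nat.cast_nonneg T
      nlinarith
    refine ⟨T, by exact_mod_cast hTn, ?_, ?_⟩
    · have h1 : (T : ℝ) * (2 ^ T * l) ≤ 2 * l * (2 ^ T * l) :=
        mul_le_mul_of_nonneg_right hTl (by positivity)
      nlinarith
    · rw [mul_div_assoc', div_le_iff₀ hpow]
      have h1 : (T : ℝ) + 1 ≤ 4 * l := by linarith
      calc (n : ℝ) * (T + 1) ≤ (2 ^ (T + 1) * (16 * l ^ 2)) * (4 * l) :=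
            mul_le_mul hT2.le h1 (by positivity) (by positivity)
        _ = _ := by ring

/-- A graph in which every labelling of the vertices by points of the grid `[n]^q` is weakly
decreasing along some edge forces monochromatic monotone paths with `n` edges. -/
lemma exists_hasPathMulti {N n q : ℕ} (H : SimpleGraph (Fin N))
    (hH : ∀ f : Fin N → Fin q → Fin n, ∃ u v, u < v ∧ H.Adj u v ∧ ∀ i, f v i ≤ f u i)
    (col : Fin N → Fin N → Fin q) : ∃ c : Fin q, HasPathMulti H n col c := by
  classical
  by_contra! hcon
  let P : Fin q → Fin N → ℕ → Prop := fun c v ℓ => ∃ w : Fin (ℓ + 1) → Fin N,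
    IsMonoPath H w ∧ (∀ i : Fin ℓ, col (w i.castSucc) (w i.succ) = c) ∧ w (Fin.last ℓ) = v
  have hP0 : ∀ c v, P c v 0 := fun c v =>
    ⟨fun _ => v, ⟨fun i j hij => absurd hij (by omega), fun i => i.elim0⟩, fun i => i.elim0, rfl⟩
  have hPn : ∀ c v, ¬ P c v n := fun c v ⟨w, h1, h2, _⟩ => hcon c ⟨w, h1, h2⟩
  have hstep : ∀ c u v ℓ, P c u ℓ → u < v → H.Adj u v → col u v = c → P c v (ℓ + 1) := by
    rintro c u v ℓ ⟨w, ⟨hw1, hw2⟩, hw3, hw4⟩ huv hadj hc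
    have hcases : ∀ Q : Fin N → Fin N → Prop, (∀ i : Fin ℓ, Q (w i.castSucc) (w i.succ)) →
        Q u v → ∀ i : Fin (ℓ + 1), Q (Fin.snoc (α := fun _ => Fin N) w v i.castSucc)
          (Fin.snoc (α := fun _ => Fin N) w v i.succ) := by
      intro Q h1 h2 i
      induction i using Fin.lastCases with
      | last =>
        rw [Fin.succ_last, Fin.snoc_castSucc, Fin.snoc_last, hw4]
        exact h2
      | cast i =>
        rw [Fin.succ_castSucc, Fin.snoc_castSucc, Fin.snoc_castSucc]
        exact h1 i
    refine ⟨Fin.snoc (α := fun _ => Fin N) w v, ⟨?_, hcases _ hw2 hadj⟩,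
      hcases (fun a b => col a b = c) hw3 hc, Fin.snoc_last _ _⟩
    exact Fin.strictMono_iff_lt_succ.2
      (hcases (· < ·) (fun i => hw1 (Fin.castSucc_lt_succ)) huv)
  have hspec : ∀ c v, P c v (Nat.findGreatest (P c v) n) := fun c v =>
    Nat.findGreatest_spec (Nat.zero_le n) (hP0 c v)
  have hlt : ∀ c v, Nat.findGreatest (P c v) n < n := fun c v =>
    lt_of_le_of_ne (Nat.findGreatest_le n) fun h => hPn c v (by simpa only [h] using hspec c v)
  obtain ⟨u, v, huv, hadj, hle⟩ := hH fun v c => ⟨Nat.findGreatest (P c v) n, hlt c v⟩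
  have h1 := hstep _ u v _ (hspec (col u v) u) huv hadj rfl
  have h2 := Nat.le_findGreatest (hlt (col u v) u) h1
  exact absurd (h2.trans (hle (col u v))) (by simp)

lemma exists_graph_of_edges {N : ℕ} (E : Finset (Fin N × Fin N)) :
    ∃ H : SimpleGraph (Fin N), H.edgeSet.ncard ≤ E.card ∧ ∀ x ∈ E, x.1 ≠ x.2 → H.Adj x.1 x.2 := by
  classical
  refine ⟨SimpleGraph.fromRel fun u v => (u, v) ∈ E, ?_, fun x hx hne => ?_⟩
  · have hsub : (SimpleGraph.fromRel fun u v => (u, v) ∈ E).edgeSet ⊆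
        (E.image fun x => s(x.1, x.2) : Finset (Sym2 (Fin N))) := by
      intro e
      induction e using Sym2.ind with
      | _ u v =>
        intro he
        rw [SimpleGraph.mem_edgeSet, SimpleGraph.fromRel_adj] at he
        rw [Finset.mem_coe, Finset.mem_image]
        rcases he.2 with h | h
        · exact ⟨_, h, rfl⟩
        · exact ⟨_, h, Sym2.eq_swap⟩
    calc _ ≤ ((E.image fun x => s(x.1, x.2) : Finset (Sym2 (Fin N))) : Set _).ncard :=
          Set.ncard_le_ncard hsub (Finset.finite_toSet _)
      _ ≤ E.card := by
          rw [Set.ncard_coe_finset]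
          exact Finset.card_image_le
  · rw [SimpleGraph.fromRel_adj]
    exact ⟨hne, Or.inl hx⟩

theorem stmt_13 :
    ∃ C : ℝ, 0 < C ∧ ∀ n q : ℕ, 2 ≤ n → 2 ≤ q →
      (∃ (N : ℕ) (H : SimpleGraph (Fin N)),
        (H.edgeSet.ncard : ℝ) ≤ C * (n : ℝ) ^ (2 * q - 1) * (Real.log n) ^ 3 ∧
        ∀ col : Fin N → Fin N → Fin q, ∃ c : Fin q, HasPathMulti H n col c) ∧
      (orderedSizeRamseyMulti n q : ℝ) ≤ C * (n : ℝ) ^ (2 * q - 1) * (Real.log n) ^ 3 := by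
  refine ⟨8192, by norm_num, fun n q hn hq => ?_⟩
  obtain ⟨N, H, hcard, hH⟩ : ∃ (N : ℕ) (H : SimpleGraph (Fin N)),
      (H.edgeSet.ncard : ℝ) ≤ 8192 * (n : ℝ) ^ (2 * q - 1) * (Real.log n) ^ 3 ∧
      ∀ col : Fin N → Fin N → Fin q, ∃ c : Fin q, HasPathMulti H n col c := by
    obtain ⟨T, hT1, hT2, hT3⟩ := exists_scale hn
    obtain ⟨E, hE, hhit⟩ := exists_edges_meeting_descents hn (by omega : 1 ≤ q) hT1 hT2
    obtain ⟨H, hHE, hadj⟩ := exists_graph_of_edges E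
    refine ⟨_, H, ?_, exists_hasPathMulti H fun f => ?_⟩
    · have hpow : (n : ℝ) ^ (2 * q) = n ^ (2 * q - 1) * n := by
        rw [← pow_succ, Nat.sub_add_cancel (by omega)]
      calc (H.edgeSet.ncard : ℝ) ≤ E.card := by exact_mod_cast hHE
        _ ≤ 64 * n ^ (2 * q) * ((T + 1) / 2 ^ T) := hE
        _ = 64 * n ^ (2 * q - 1) * (n * (((T : ℝ) + 1) / 2 ^ T)) := by rw [hpow]; ring
        _ ≤ 64 * n ^ (2 * q - 1) * (128 * Real.log n ^ 3) :=
            mul_le_mul_of_nonneg_left hT3 (by positivity)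
        _ = _ := by ring
    · obtain ⟨x, hxE, hx⟩ := hhit f
      simp only [descents, Finset.mem_filter, Finset.mem_univ, true_and] at hx
      exact ⟨x.1, x.2, hx.1, hadj x hxE hx.1.ne, hx.2⟩
  refine ⟨⟨N, H, hcard, hH⟩, le_trans ?_ hcard⟩
  have hle : orderedSizeRamseyMulti n q ≤ H.edgeSet.ncard := Nat.sInf_le ⟨N, H, rfl, hH⟩
  exact_mod_cast hle
end
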